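/- For every integer m ≥ 1, the rational function h_m(v) has at most a simple pole at v = 1/m and Res_{v=1/m} h_m(v) = (−1)^{m+k+1}·c(m) / (m·16^m). -/

import Mathlib

open Polynomial Complex Filter Topology

noncomputable section

/-- `θ₂(τ) = ∑_{n ∈ ℤ} exp(πi(n+1/2)²τ)`. -/
def theta2 (τ : ℂ) : ℂ := ∑' n : ℤ, Complex.exp (Real.pi * Complex.I * ((n : ℂ) + 1/2) ^ 2 * τ)

/-- `θ₄(τ) = ∑_{n ∈ ℤ} (-1)ⁿ exp(πin²τ)`. -/
def theta4 (τ : ℂ) : ℂ :=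
  ∑' n : ℤ, (-1 : ℂ) ^ n * Complex.exp (Real.pi * Complex.I * (n : ℂ) ^ 2 * τ)

/-- `x(τ) = -θ₄(τ)⁴`. -/
def xx (τ : ℂ) : ℂ := -(theta4 τ) ^ 4

/-- `y(τ) = θ₂(τ)⁴`. -/
def yy (τ : ℂ) : ℂ := (theta2 τ) ^ 4

/-- Derivative of a rational function. -/
def ratDeriv (f : RatFunc ℂ) : RatFunc ℂ :=
  RatFunc.mk (Polynomial.derivative f.num * f.denom - f.num * Polynomial.derivative f.denom)
    (f.denom ^ 2)


/-- `θ₃(τ) = ∑_{n ∈ ℤ} exp(πin²τ)`. -/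
def theta3 (τ : ℂ) : ℂ := ∑' n : ℤ, Complex.exp (Real.pi * Complex.I * (n : ℂ) ^ 2 * τ)

lemma summable_norm_theta3 {τ : ℂ} (hτ : 0 < τ.im) :
    Summable (fun n : ℤ => ‖Complex.exp (Real.pi * Complex.I * (n : ℂ) ^ 2 * τ)‖) := by
  have := ((summable_jacobiTheta₂_term_iff 0 τ).2 hτ).norm
  refine this.congr fun n => ?_
  simp [jacobiTheta₂_term]

lemma norm_neg_one_zpow (n : ℤ) : ‖(-1 : ℂ) ^ n‖ = 1 := by
  rw [norm_zpow]; simp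

lemma summable_norm_theta4 {τ : ℂ} (hτ : 0 < τ.im) :
    Summable (fun n : ℤ => ‖(-1 : ℂ) ^ n * Complex.exp (Real.pi * Complex.I * (n : ℂ) ^ 2 * τ)‖) := by
  refine (summable_norm_theta3 hτ).congr fun n => ?_
  rw [norm_mul, norm_neg_one_zpow, one_mul]

lemma summable_norm_theta2 {τ : ℂ} (hτ : 0 < τ.im) :
    Summable (fun n : ℤ => ‖Complex.exp (Real.pi * Complex.I * ((n : ℂ) + 1/2) ^ 2 * τ)‖) := by
  have := (((summable_jacobiTheta₂_term_iff (τ / 2) τ).2 hτ).mul_left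
    (Complex.exp (Real.pi * Complex.I * τ / 4))).norm
  refine this.congr fun n => ?_
  rw [jacobiTheta₂_term, ← Complex.exp_add]
  congr 2
  ring

lemma tsum_even_part (F : ℤ × ℤ → ℂ) (hF : ∀ m n : ℤ, Odd (m + n) → F (m, n) = 0) :
    ∑' p, F p = ∑' p : ℤ × ℤ, F (p.1 + p.2, p.1 - p.2) := by
  have hinj : Function.Injective (fun p : ℤ × ℤ => (p.1 + p.2, p.1 - p.2)) := by
    rintro ⟨a, b⟩ ⟨c, d⟩ h
    simp only [Prod.mk.injEq] at h ⊢
    omega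
  refine (hinj.tsum_eq (f := F) ?_).symm
  rintro ⟨m, n⟩ h
  have : ¬ Odd (m + n) := fun h' => h (hF m n h')
  rw [Int.not_odd_iff_even] at this
  obtain ⟨r, hr⟩ := this
  exact ⟨(r, m - r), by simp only [Prod.mk.injEq]; omega⟩

lemma tsum_odd_part (F : ℤ × ℤ → ℂ) (hF : ∀ m n : ℤ, Even (m + n) → F (m, n) = 0) :
    ∑' p, F p = ∑' p : ℤ × ℤ, F (p.1 + p.2 + 1, p.1 - p.2) := by
  have hinj : Function.Injective (fun p : ℤ × ℤ => (p.1 + p.2 + 1, p.1 - p.2)) := by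
    rintro ⟨a, b⟩ ⟨c, d⟩ h
    simp only [Prod.mk.injEq] at h ⊢
    omega
  refine (hinj.tsum_eq (f := F) ?_).symm
  rintro ⟨m, n⟩ h
  have : ¬ Even (m + n) := fun h' => h (hF m n h')
  rw [Int.not_even_iff_odd] at this
  obtain ⟨r, hr⟩ := this
  exact ⟨(r, m - r - 1), by simp only [Prod.mk.injEq]; omega⟩

lemma im_two_mul {τ : ℂ} (hτ : 0 < τ.im) : 0 < (2 * τ).im := by
  simpa using hτ

/-- `θ₃²` as a double sum, and so on. -/
lemma theta3_sq {τ : ℂ} (hτ : 0 < τ.im) : theta3 τ ^ 2 = ∑' p : ℤ × ℤ,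
    Complex.exp (Real.pi * Complex.I * (p.1 : ℂ) ^ 2 * τ) *
    Complex.exp (Real.pi * Complex.I * (p.2 : ℂ) ^ 2 * τ) := by
  rw [sq, theta3]
  exact tsum_mul_tsum_of_summable_norm (summable_norm_theta3 hτ) (summable_norm_theta3 hτ)

lemma theta4_sq {τ : ℂ} (hτ : 0 < τ.im) : theta4 τ ^ 2 = ∑' p : ℤ × ℤ,
    ((-1 : ℂ) ^ p.1 * Complex.exp (Real.pi * Complex.I * (p.1 : ℂ) ^ 2 * τ)) *
    ((-1 : ℂ) ^ p.2 * Complex.exp (Real.pi * Complex.I * (p.2 : ℂ) ^ 2 * τ)) := by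
  rw [sq, theta4]
  exact tsum_mul_tsum_of_summable_norm (summable_norm_theta4 hτ) (summable_norm_theta4 hτ)

lemma theta2_sq {τ : ℂ} (hτ : 0 < τ.im) : theta2 τ ^ 2 = ∑' p : ℤ × ℤ,
    (Complex.exp (Real.pi * Complex.I * ((p.1 : ℂ) + 1/2) ^ 2 * τ)) *
    (Complex.exp (Real.pi * Complex.I * ((p.2 : ℂ) + 1/2) ^ 2 * τ)) := by
  rw [sq, theta2]
  exact tsum_mul_tsum_of_summable_norm (summable_norm_theta2 hτ) (summable_norm_theta2 hτ)

lemma theta34 {τ : ℂ} (hτ : 0 < τ.im) : theta3 τ * theta4 τ = ∑' p : ℤ × ℤ,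
    (Complex.exp (Real.pi * Complex.I * (p.1 : ℂ) ^ 2 * τ)) *
    ((-1 : ℂ) ^ p.2 * Complex.exp (Real.pi * Complex.I * (p.2 : ℂ) ^ 2 * τ)) := by
  rw [theta3, theta4]
  exact tsum_mul_tsum_of_summable_norm (summable_norm_theta3 hτ) (summable_norm_theta4 hτ)

lemma theta23 {τ : ℂ} (hτ : 0 < τ.im) : theta2 τ * theta3 τ = ∑' p : ℤ × ℤ,
    (Complex.exp (Real.pi * Complex.I * ((p.1 : ℂ) + 1/2) ^ 2 * τ)) *
    (Complex.exp (Real.pi * Complex.I * (p.2 : ℂ) ^ 2 * τ)) := by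
  rw [theta3, theta2]
  exact tsum_mul_tsum_of_summable_norm (summable_norm_theta2 hτ) (summable_norm_theta3 hτ)

lemma neg_one_zpow_mul_odd {m n : ℤ} (h : Odd (m + n)) : (-1 : ℂ) ^ m * (-1 : ℂ) ^ n = -1 := by
  rw [← zpow_add₀ (by norm_num), h.neg_one_zpow]

lemma neg_one_zpow_mul_even {m n : ℤ} (h : Even (m + n)) : (-1 : ℂ) ^ m * (-1 : ℂ) ^ n = 1 := by
  rw [← zpow_add₀ (by norm_num), h.neg_one_zpow]

lemma theta_T1 {τ : ℂ} (hτ : 0 < τ.im) :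
    theta3 τ ^ 2 + theta4 τ ^ 2 = 2 * theta3 (2 * τ) ^ 2 := by
  have s3 := summable_mul_of_summable_norm (summable_norm_theta3 hτ) (summable_norm_theta3 hτ)
  have s4 := summable_mul_of_summable_norm (summable_norm_theta4 hτ) (summable_norm_theta4 hτ)
  rw [theta3_sq hτ, theta4_sq hτ, theta3_sq (im_two_mul hτ), ← s3.tsum_add s4, tsum_even_part,
    ← tsum_mul_left]
  · refine tsum_congr fun p => ?_
    have h := neg_one_zpow_mul_even (m := p.1 + p.2) (n := p.1 - p.2) ⟨p.1, by ring⟩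
    rw [mul_mul_mul_comm, h, one_mul, ← two_mul, ← Complex.exp_add, ← Complex.exp_add]
    congr 2
    push_cast
    ring
  · intro m n h
    have h := neg_one_zpow_mul_odd h
    simp only
    rw [mul_mul_mul_comm, h]
    ring

lemma theta_T3a {τ : ℂ} (hτ : 0 < τ.im) :
    theta3 τ ^ 2 - theta4 τ ^ 2 = 2 * theta2 (2 * τ) ^ 2 := by
  have s3 := summable_mul_of_summable_norm (summable_norm_theta3 hτ) (summable_norm_theta3 hτ)
  have s4 := summable_mul_of_summable_norm (summable_norm_theta4 hτ) (summable_norm_theta4 hτ)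
  rw [theta3_sq hτ, theta4_sq hτ, theta2_sq (im_two_mul hτ), ← s3.tsum_sub s4, tsum_odd_part,
    ← tsum_mul_left]
  · refine tsum_congr fun p => ?_
    have h := neg_one_zpow_mul_odd (m := p.1 + p.2 + 1) (n := p.1 - p.2) ⟨p.1, by ring⟩
    rw [mul_mul_mul_comm, h, neg_one_mul, sub_neg_eq_add, ← two_mul, ← Complex.exp_add,
      ← Complex.exp_add]
    congr 2
    push_cast
    ring
  · intro m n h
    have h := neg_one_zpow_mul_even h
    simp only
    rw [mul_mul_mul_comm, h]
    ring

lemma theta_T2 {τ : ℂ} (hτ : 0 < τ.im) :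
    theta3 τ * theta4 τ = theta4 (2 * τ) ^ 2 := by
  have s := summable_mul_of_summable_norm (summable_norm_theta3 hτ) (summable_norm_theta4 hτ)
  have s' := summable_mul_of_summable_norm (summable_norm_theta4 hτ) (summable_norm_theta3 hτ)
  have e : theta4 τ * theta3 τ = ∑' p : ℤ × ℤ,
    ((-1 : ℂ) ^ p.1 * Complex.exp (Real.pi * Complex.I * (p.1 : ℂ) ^ 2 * τ)) *
    (Complex.exp (Real.pi * Complex.I * (p.2 : ℂ) ^ 2 * τ)) := by
    rw [theta3, theta4]
    exact tsum_mul_tsum_of_summable_norm (summable_norm_theta4 hτ) (summable_norm_theta3 hτ)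
  have h2 : 2 * (theta3 τ * theta4 τ) = 2 * theta4 (2 * τ) ^ 2 := by
    have : 2 * (theta3 τ * theta4 τ) = theta3 τ * theta4 τ + theta4 τ * theta3 τ := by ring
    rw [this, e, theta34 hτ, theta4_sq (im_two_mul hτ), ← s.tsum_add s', tsum_even_part,
      ← tsum_mul_left]
    · refine tsum_congr fun p => ?_
      have h : (-1 : ℂ) ^ (p.1 - p.2) = (-1 : ℂ) ^ (p.1 + p.2) := by
        have : p.1 + p.2 = (p.1 - p.2) + 2 * p.2 := by ring
        rw [this, zpow_add₀ (by norm_num), zpow_mul]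
        simp
      have h3 : (-1 : ℂ) ^ (p.1 + p.2) = (-1) ^ p.1 * (-1) ^ p.2 := by
        rw [zpow_add₀ (by norm_num)]
      have h4 : Complex.exp (Real.pi * Complex.I * ((p.1 + p.2 : ℤ) : ℂ) ^ 2 * τ) *
          Complex.exp (Real.pi * Complex.I * ((p.1 - p.2 : ℤ) : ℂ) ^ 2 * τ) =
          Complex.exp (Real.pi * Complex.I * (p.1 : ℂ) ^ 2 * (2 * τ)) *
          Complex.exp (Real.pi * Complex.I * (p.2 : ℂ) ^ 2 * (2 * τ)) := by
        rw [← Complex.exp_add, ← Complex.exp_add]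
        congr 1
        push_cast
        ring
      simp only
      rw [h, h3]
      linear_combination (2 * (-1) ^ p.1 * (-1) ^ p.2) * h4
    · intro m n h
      have h := neg_one_zpow_mul_odd h
      have h2 : (-1 : ℂ) ^ n * (-1) ^ n = 1 := neg_one_zpow_mul_even ⟨n, rfl⟩
      have h3 : (-1 : ℂ) ^ m + (-1) ^ n = 0 := by
        linear_combination (-1 : ℂ) ^ n * h - (-1 : ℂ) ^ m * h2
      simp only
      linear_combination Complex.exp (Real.pi * Complex.I * (m : ℂ) ^ 2 * τ) *
        Complex.exp (Real.pi * Complex.I * (n : ℂ) ^ 2 * τ) * h3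
  exact mul_left_cancel₀ two_ne_zero h2

lemma theta_T3b {τ : ℂ} (hτ : 0 < τ.im) :
    theta2 τ ^ 2 = 2 * (theta2 (2 * τ) * theta3 (2 * τ)) := by
  have s := summable_mul_of_summable_norm (summable_norm_theta2 hτ) (summable_norm_theta2 hτ)
  set f : ℤ × ℤ → ℂ := fun p =>
    (Complex.exp (Real.pi * Complex.I * ((p.1 : ℂ) + 1/2) ^ 2 * τ)) *
    (Complex.exp (Real.pi * Complex.I * ((p.2 : ℂ) + 1/2) ^ 2 * τ)) with hf
  -- the sum weighted by `(-1)^(m+n)` vanishes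
  let σ : ℤ × ℤ ≃ ℤ × ℤ := (Equiv.refl ℤ).prodCongr
    ⟨fun n => -1 - n, fun n => -1 - n, fun n => by ring, fun n => by ring⟩
  have hσ : ∀ p, f (σ p) = f p := by
    rintro ⟨m, n⟩
    simp only [hf, σ, Equiv.prodCongr_apply, Prod.map_apply, Equiv.refl_apply, Equiv.coe_fn_mk]
    congr 2
    push_cast
    ring
  have sw : Summable (fun p : ℤ × ℤ => (-1 : ℂ) ^ (p.1 + p.2) * f p) := by
    refine Summable.of_norm (s.norm.congr fun p => ?_)
    have : ‖(-1 : ℂ) ^ (p.1 + p.2) * f p‖ = ‖f p‖ := by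
      rw [norm_mul, norm_neg_one_zpow, one_mul]
    exact this.symm
  have hz : ∑' p : ℤ × ℤ, (-1 : ℂ) ^ (p.1 + p.2) * f p = 0 := by
    have h1 := σ.tsum_eq (fun p : ℤ × ℤ => (-1 : ℂ) ^ (p.1 + p.2) * f p)
    have h2 : ∀ p : ℤ × ℤ, (-1 : ℂ) ^ ((σ p).1 + (σ p).2) * f (σ p) =
        -((-1 : ℂ) ^ (p.1 + p.2) * f p) := by
      rintro ⟨m, n⟩
      rw [hσ]
      have : (σ (m, n)).1 + (σ (m, n)).2 = (m + n) + (- 2 * n - 1) := by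
        simp only [σ, Equiv.prodCongr_apply, Prod.map_apply, Equiv.refl_apply, Equiv.coe_fn_mk]
        ring
      rw [this, zpow_add₀ (by norm_num), (show Odd (-2 * n - 1) from ⟨-n - 1, by ring⟩).neg_one_zpow]
      ring
    rw [tsum_congr h2, tsum_neg] at h1
    linear_combination (-1 / 2 : ℂ) * h1
  have h1 : theta2 τ ^ 2 = ∑' p : ℤ × ℤ, (f p + (-1 : ℂ) ^ (p.1 + p.2) * f p) := by
    rw [s.tsum_add sw, hz, theta2_sq hτ, add_zero]
  rw [h1, theta23 (im_two_mul hτ), tsum_even_part, ← tsum_mul_left]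
  · refine tsum_congr fun p => ?_
    simp only
    rw [(show Even (p.1 + p.2 + (p.1 - p.2)) from ⟨p.1, by ring⟩).neg_one_zpow, one_mul, ← two_mul]
    congr 1
    rw [hf, ← Complex.exp_add]
    simp only
    rw [← Complex.exp_add]
    congr 1
    push_cast
    ring
  · intro m n h
    simp only
    rw [h.neg_one_zpow]
    ring

lemma theta_T3 {τ : ℂ} (hτ : 0 < τ.im) :
    theta2 τ ^ 4 = theta3 τ ^ 4 - theta4 τ ^ 4 := by
  have h1 := theta_T1 hτ
  have h2 := theta_T3a hτ
  have h3 := theta_T3b hτ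
  have : theta2 τ ^ 4 = (theta2 τ ^ 2) ^ 2 := by ring
  rw [this, h3]
  linear_combination (-(theta3 τ ^ 2) + theta4 τ ^ 2) * h1 - 2 * theta3 (2 * τ) ^ 2 * h2

/-- `f` is represented on the upper half plane by the power series `A` in `q = exp(πiτ)`. -/
def QRep (f : ℂ → ℂ) (A : PowerSeries ℂ) : Prop :=
  ∀ τ : ℂ, 0 < τ.im →
    Summable (fun n : ℕ => ‖PowerSeries.coeff n A * Complex.exp (Real.pi * Complex.I * n * τ)‖) ∧
    f τ = ∑' n : ℕ, PowerSeries.coeff n A * Complex.exp (Real.pi * Complex.I * n * τ)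

lemma QRep.congr {f g : ℂ → ℂ} {A : PowerSeries ℂ} (hf : QRep f A)
    (h : ∀ τ : ℂ, 0 < τ.im → f τ = g τ) : QRep g A := by
  intro τ hτ
  exact ⟨(hf τ hτ).1, (h τ hτ) ▸ (hf τ hτ).2⟩

lemma QRep.add {f g : ℂ → ℂ} {A B : PowerSeries ℂ} (hf : QRep f A) (hg : QRep g B) :
    QRep (fun τ => f τ + g τ) (A + B) := by
  intro τ hτ
  obtain ⟨h1, h2⟩ := hf τ hτ
  obtain ⟨h3, h4⟩ := hg τ hτ
  have e : ∀ n : ℕ, PowerSeries.coeff n (A + B) * Complex.exp (Real.pi * Complex.I * n * τ) =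
      PowerSeries.coeff n A * Complex.exp (Real.pi * Complex.I * n * τ) +
      PowerSeries.coeff n B * Complex.exp (Real.pi * Complex.I * n * τ) := by
    intro n; rw [map_add, add_mul]
  simp only [e]
  refine ⟨(h1.of_norm.add h3.of_norm).norm, ?_⟩
  rw [h1.of_norm.tsum_add h3.of_norm, h2, h4]

lemma QRep.mul {f g : ℂ → ℂ} {A B : PowerSeries ℂ} (hf : QRep f A) (hg : QRep g B) :
    QRep (fun τ => f τ * g τ) (A * B) := by
  intro τ hτ
  obtain ⟨h1, h2⟩ := hf τ hτ
  obtain ⟨h3, h4⟩ := hg τ hτ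
  have e : ∀ n : ℕ, PowerSeries.coeff n (A * B) * Complex.exp (Real.pi * Complex.I * n * τ) =
      ∑ p ∈ Finset.HasAntidiagonal.antidiagonal n,
      (PowerSeries.coeff p.1 A * Complex.exp (Real.pi * Complex.I * p.1 * τ)) *
      (PowerSeries.coeff p.2 B * Complex.exp (Real.pi * Complex.I * p.2 * τ)) := by
    intro n
    rw [PowerSeries.coeff_mul, Finset.sum_mul]
    refine Finset.sum_congr rfl fun p hp => ?_
    rw [← Finset.HasAntidiagonal.mem_antidiagonal.1 hp, mul_mul_mul_comm, ← Complex.exp_add]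
    congr 2
    push_cast
    ring
  have k1 := summable_norm_sum_mul_antidiagonal_of_summable_norm h1 h3
  have k2 := tsum_mul_tsum_eq_tsum_sum_antidiagonal_of_summable_norm h1 h3
  refine ⟨k1.congr fun n => ?_, ?_⟩
  · rw [e n]
  · calc f τ * g τ = _ := by rw [h2, h4]
      _ = _ := k2
      _ = _ := tsum_congr fun n => (e n).symm

lemma QRep.const (z : ℂ) : QRep (fun _ => z) (PowerSeries.C z) := by
  intro τ hτ
  have e : ∀ n : ℕ, n ≠ 0 → PowerSeries.coeff n (PowerSeries.C z) *
      Complex.exp (Real.pi * Complex.I * n * τ) = 0 := by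
    intro n hn
    rw [PowerSeries.coeff_C, if_neg hn, zero_mul]
  constructor
  · refine summable_of_ne_finset_zero (s := {0}) ?_
    intro n hn
    rw [e n (by simpa using hn), norm_zero]
  · rw [tsum_eq_single 0 e]
    simp

lemma QRep.sub {f g : ℂ → ℂ} {A B : PowerSeries ℂ} (hf : QRep f A) (hg : QRep g B) :
    QRep (fun τ => f τ - g τ) (A - B) := by
  have := hf.add ((QRep.const (-1)).mul hg)
  have e : A + PowerSeries.C (-1) * B = A - B := by
    rw [map_neg, map_one]; ring
  rw [e] at this
  exact this.congr fun τ _ => by ring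

lemma QRep.pow {f : ℂ → ℂ} {A : PowerSeries ℂ} (hf : QRep f A) (n : ℕ) :
    QRep (fun τ => f τ ^ n) (A ^ n) := by
  induction n with
  | zero => simpa using QRep.const 1
  | succ n ih => simpa only [pow_succ] using ih.mul hf

lemma QRep.mvaeval {f g : ℂ → ℂ} {A B : PowerSeries ℂ} (hf : QRep f A) (hg : QRep g B)
    (P : MvPolynomial (Fin 2) ℂ) :
    QRep (fun τ => MvPolynomial.eval ![f τ, g τ] P) (MvPolynomial.aeval ![A, B] P) := by
  induction P using MvPolynomial.induction_on with
  | C a => simpa [PowerSeries.algebraMap_apply] using QRep.const a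
  | add p q hp hq => simpa using hp.add hq
  | mul_X p i hp =>
    fin_cases i
    · simpa using hp.mul hf
    · simpa using hp.mul hg

lemma QRep.expand {f : ℂ → ℂ} {A : PowerSeries ℂ} (hf : QRep f A) :
    QRep (fun τ => f (2 * τ)) (PowerSeries.expand 2 two_ne_zero A) := by
  intro τ hτ
  obtain ⟨h1, h2⟩ := hf (2 * τ) (by simpa using hτ)
  have hinj : Function.Injective (fun n : ℕ => 2 * n) := fun a b h => by
    simp only at h; omega
  have e : ∀ n : ℕ, PowerSeries.coeff (2 * n) (PowerSeries.expand 2 two_ne_zero A) *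
      Complex.exp (Real.pi * Complex.I * (2 * n : ℕ) * τ) =
      PowerSeries.coeff n A * Complex.exp (Real.pi * Complex.I * n * (2 * τ)) := by
    intro n
    rw [PowerSeries.coeff_expand_mul]
    congr 2
    push_cast
    ring
  have hz : ∀ n ∉ Set.range (fun n : ℕ => 2 * n),
      PowerSeries.coeff n (PowerSeries.expand 2 two_ne_zero A) *
      Complex.exp (Real.pi * Complex.I * n * τ) = 0 := by
    intro n hn
    rw [PowerSeries.coeff_expand_of_not_dvd, zero_mul]
    rintro ⟨m, rfl⟩
    exact hn ⟨m, rfl⟩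
  have hs : Summable (fun n : ℕ => PowerSeries.coeff n (PowerSeries.expand 2 two_ne_zero A) *
      Complex.exp (Real.pi * Complex.I * n * τ)) := by
    refine (hinj.summable_iff hz).1 ?_
    refine h1.of_norm.congr fun n => ?_
    exact (e n).symm
  refine ⟨hs.norm, ?_⟩
  simp only
  rw [h2, ← hinj.tsum_eq (f := fun n : ℕ => PowerSeries.coeff n (PowerSeries.expand 2 two_ne_zero A) *
      Complex.exp (Real.pi * Complex.I * n * τ))]
  · exact tsum_congr fun n => (e n).symm
  · intro n hn
    by_contra h
    exact hn (hz n h)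

/-- Power series expansions are unique. -/
lemma QRep.unique {f : ℂ → ℂ} {A B : PowerSeries ℂ} (hf : QRep f A) (hg : QRep f B) : A = B := by
  have key : ∀ D : PowerSeries ℂ, QRep (fun _ => 0) D → D = 0 := by
    intro D hD
    have hq : ∀ z : ℂ, z ≠ 0 → ‖z‖ < 1 → HasSum (fun n : ℕ => PowerSeries.coeff n D * z ^ n) 0 := by
      intro z hz hz1
      set τ : ℂ := Complex.log z / (Real.pi * Complex.I) with hτ
      have hpi : (Real.pi * Complex.I : ℂ) ≠ 0 := by
        simp [Real.pi_ne_zero]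
      have him : 0 < τ.im := by
        have : τ = -(Complex.I * Complex.log z) / (Real.pi : ℝ) := by
          rw [hτ]
          have : (Real.pi : ℂ) ≠ 0 := by simp [Real.pi_ne_zero]
          field_simp
          rw [Complex.I_sq]
          ring
        rw [this, Complex.div_ofReal_im]
        apply div_pos _ Real.pi_pos
        simp only [Complex.neg_im, Complex.mul_im, Complex.I_re, Complex.I_im, Complex.log_re]
        have := Real.log_neg (norm_pos_iff.2 hz) hz1
        linarith
      obtain ⟨h1, h2⟩ := hD τ him
      have e : ∀ n : ℕ, Complex.exp (Real.pi * Complex.I * n * τ) = z ^ n := by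
        intro n
        have : Real.pi * Complex.I * n * τ = n * Complex.log z := by
          rw [hτ]; field_simp
        rw [this, Complex.exp_nat_mul, Complex.exp_log hz]
      simp only [e] at h1 h2
      rw [h2]
      exact h1.of_norm.hasSum
    set p := FormalMultilinearSeries.ofScalars ℂ (fun n => PowerSeries.coeff n D) with hp
    set F : ℂ → ℂ := fun z => ∑' n : ℕ, PowerSeries.coeff n D * z ^ n with hF
    have hps : HasFPowerSeriesAt F p 0 := by
      rw [hasFPowerSeriesAt_iff]
      filter_upwards [Metric.ball_mem_nhds (0 : ℂ) one_pos] with z hz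
      have hz : ‖z‖ < 1 := by simpa using hz
      simp only [hp, FormalMultilinearSeries.coeff_ofScalars, smul_eq_mul, zero_add]
      have hsum : Summable (fun n : ℕ => PowerSeries.coeff n D * z ^ n) := by
        rcases eq_or_ne z 0 with rfl | h0
        · refine summable_of_ne_finset_zero (s := {0}) ?_
          intro n hn
          simp [show n ≠ 0 by simpa using hn]
        · exact (hq z h0 hz).summable
      refine hsum.hasSum.congr_fun ?_
      intro n
      ring
    have hev : ∀ᶠ z in 𝓝[≠] (0 : ℂ), F z = 0 := by
      have : Metric.ball (0 : ℂ) 1 ∈ 𝓝[≠] (0 : ℂ) :=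
        mem_nhdsWithin_of_mem_nhds (Metric.ball_mem_nhds (0 : ℂ) one_pos)
      filter_upwards [this, self_mem_nhdsWithin] with z hz h0
      exact (hq z h0 (by simpa using hz)).tsum_eq
    have hev2 := (AnalyticAt.frequently_zero_iff_eventually_zero hps.analyticAt).1 hev.frequently
    have hp0 := hps.eq_zero_of_eventually hev2
    ext n
    have := congrArg (fun p => FormalMultilinearSeries.coeff p n) hp0
    simp only [hp, FormalMultilinearSeries.coeff_ofScalars] at this
    rw [this, map_zero]
    simp [FormalMultilinearSeries.coeff]
  have := hf.sub hg
  simp only [sub_self] at this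
  exact sub_eq_zero.1 (key _ this)

/-- Regrouping a lacunary series. -/
lemma rep_of_fibers (e : ℤ → ℕ) (w : ℤ → ℂ)
    (hs : ∀ τ : ℂ, 0 < τ.im →
      Summable (fun n : ℤ => w n * Complex.exp (Real.pi * Complex.I * (e n : ℂ) * τ))) :
    QRep (fun τ => ∑' n : ℤ, w n * Complex.exp (Real.pi * Complex.I * (e n : ℂ) * τ))
      (PowerSeries.mk fun N => ∑' n : {n : ℤ // e n = N}, w n) := by
  intro τ hτ
  have h1 := hs τ hτ
  have h2 := ((Equiv.sigmaFiberEquiv e).summable_iff.2 h1)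
  have h3 := h2.sigma
  have h4 := h2.tsum_sigma
  have h6 := (Equiv.sigmaFiberEquiv e).tsum_eq
    (fun n : ℤ => w n * Complex.exp (Real.pi * Complex.I * (e n : ℂ) * τ))
  have h5 : ∀ N : ℕ, ∑' n : {n : ℤ // e n = N},
      ((fun n : ℤ => w n * Complex.exp (Real.pi * Complex.I * (e n : ℂ) * τ)) ∘
        (Equiv.sigmaFiberEquiv e)) ⟨N, n⟩ =
      PowerSeries.coeff N (PowerSeries.mk fun N => ∑' n : {n : ℤ // e n = N}, w n) *
        Complex.exp (Real.pi * Complex.I * N * τ) := by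
    intro N
    rw [PowerSeries.coeff_mk, ← tsum_mul_right]
    refine tsum_congr fun n => ?_
    simp only [Function.comp, Equiv.sigmaFiberEquiv, Equiv.coe_fn_mk]
    rw [n.2]
  refine ⟨?_, ?_⟩
  · refine (h3.congr fun N => ?_).norm
    exact (h5 N)
  · exact h6.symm.trans (h4.trans (tsum_congr h5))

/-- The formal series of `∑ w(n) q^(n²)`. -/
def thetaPS (w : ℤ → ℂ) : PowerSeries ℂ :=
  PowerSeries.mk fun N => ∑' n : {n : ℤ // n.natAbs ^ 2 = N}, w n

lemma thetaPS_coeff_zero (w : ℤ → ℂ) : PowerSeries.coeff 0 (thetaPS w) = w 0 := by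
  rw [thetaPS, PowerSeries.coeff_mk]
  have : Unique {n : ℤ // n.natAbs ^ 2 = 0} :=
    ⟨⟨⟨0, by simp⟩⟩, fun n => Subtype.ext (by simpa using n.2)⟩
  rw [tsum_eq_single ⟨0, by simp⟩]
  intro b hb
  exact absurd (Subtype.ext (by simpa using b.2)) hb

lemma thetaPS_coeff_one (w : ℤ → ℂ) : PowerSeries.coeff 1 (thetaPS w) = w 1 + w (-1) := by
  rw [thetaPS, PowerSeries.coeff_mk]
  rw [tsum_eq_sum (s := {⟨1, by simp⟩, ⟨-1, by simp⟩}), Finset.sum_pair]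
  · simp [Subtype.ext_iff]
  · rintro ⟨b, hb⟩ h
    exfalso
    apply h
    have : b.natAbs = 1 := by
      have := Nat.pow_eq_one.1 hb
      omega
    simp only [Finset.mem_insert, Finset.mem_singleton, Subtype.mk.injEq]
    omega

lemma rep_thetaPS (w : ℤ → ℂ)
    (hs : ∀ τ : ℂ, 0 < τ.im →
      Summable (fun n : ℤ => w n * Complex.exp (Real.pi * Complex.I * (n : ℂ) ^ 2 * τ))) :
    QRep (fun τ => ∑' n : ℤ, w n * Complex.exp (Real.pi * Complex.I * (n : ℂ) ^ 2 * τ))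
      (thetaPS w) := by
  have e : ∀ n : ℤ, ((n.natAbs ^ 2 : ℕ) : ℂ) = (n : ℂ) ^ 2 := by
    intro n
    have : ((n.natAbs ^ 2 : ℕ) : ℤ) = n ^ 2 := by
      push_cast
      exact sq_abs n
    have h2 := congrArg (fun z : ℤ => (z : ℂ)) this
    simpa only [Int.cast_natCast, Int.cast_pow] using h2
  have := rep_of_fibers (fun n => n.natAbs ^ 2) w (by simpa only [e] using hs)
  simp only [e] at this
  exact this

lemma rep_theta3 : QRep theta3 (thetaPS fun _ => 1) := by
  refine (rep_thetaPS (fun _ => 1) ?_).congr ?_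
  · intro τ hτ
    simpa using (summable_norm_theta3 hτ).of_norm
  · intro τ _
    simp [theta3]

lemma rep_theta4 : QRep theta4 (thetaPS fun n => (-1) ^ n) := by
  refine (rep_thetaPS (fun n => (-1) ^ n) ?_).congr ?_
  · intro τ hτ
    exact (summable_norm_theta4 hτ).of_norm
  · intro τ _
    rfl

/-- The Euler derivation `q d/dq`. -/
def dl (R : Type*) [CommRing R] : Derivation R (PowerSeries R) (PowerSeries R) :=
  (PowerSeries.X : PowerSeries R) • PowerSeries.derivative R

lemma dl_apply {R : Type*} [CommRing R] (f : PowerSeries R) :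
    dl R f = PowerSeries.X * PowerSeries.derivative R f := rfl

lemma dl_mul {R : Type*} [CommRing R] (f g : PowerSeries R) :
    dl R (f * g) = f * dl R g + g * dl R f := by
  rw [Derivation.leibniz, smul_eq_mul, smul_eq_mul]

lemma coeff_dl {R : Type*} [CommRing R] (f : PowerSeries R) (n : ℕ) :
    PowerSeries.coeff n (dl R f) = n * PowerSeries.coeff n f := by
  rw [dl_apply]
  cases n with
  | zero => simp
  | succ n =>
    rw [PowerSeries.coeff_succ_X_mul, PowerSeries.coeff_derivative]
    push_cast
    ring

lemma dl_X {R : Type*} [CommRing R] : dl R (PowerSeries.X) = PowerSeries.X := by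
  rw [dl_apply, PowerSeries.derivative_X, mul_one]

/-- The substitution `q ↦ q²`. -/
def sg : PowerSeries ℂ →ₐ[ℂ] PowerSeries ℂ := PowerSeries.expand 2 two_ne_zero

lemma dl_sg (f : PowerSeries ℂ) : dl ℂ (sg f) = 2 * sg (dl ℂ f) := by
  ext n
  have h2 : (2 : PowerSeries ℂ) = PowerSeries.C 2 := (map_ofNat PowerSeries.C 2).symm
  rw [coeff_dl, h2, PowerSeries.coeff_C_mul, sg]
  by_cases h : 2 ∣ n
  · obtain ⟨m, rfl⟩ := h
    rw [PowerSeries.coeff_expand_mul, PowerSeries.coeff_expand_mul, coeff_dl]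
    push_cast
    ring
  · rw [PowerSeries.coeff_expand_of_not_dvd _ _ _ h, PowerSeries.coeff_expand_of_not_dvd _ _ _ h]
    ring

lemma sg_X : sg PowerSeries.X = PowerSeries.X ^ 2 := PowerSeries.expand_X 2 two_ne_zero

lemma eq_zero_of_X_pow_dvd {R : Type*} [CommRing R] (f : PowerSeries R)
    (h : ∀ n : ℕ, PowerSeries.X ^ n ∣ f) : f = 0 := by
  ext n
  exact PowerSeries.X_pow_dvd_iff.1 (h (n + 1)) n (by omega)

lemma coeff_zero_mul_ps {R : Type*} [CommRing R] (f g : PowerSeries R) :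
    PowerSeries.coeff 0 (f * g) = PowerSeries.coeff 0 f * PowerSeries.coeff 0 g := by
  simp

lemma theta_ode_formal (a b : PowerSeries ℂ) (h1 : a + b = 2 * sg a) (h2 : a * b = sg b ^ 2)
    (ha0 : PowerSeries.coeff 0 a = 1) (hb0 : PowerSeries.coeff 0 b = 1)
    (ha1 : PowerSeries.coeff 1 a = 4) (hb1 : PowerSeries.coeff 1 b = -4) :
    ∃ α β : PowerSeries ℂ, dl ℂ a = a * α ∧ dl ℂ b = b * β ∧ 2 * (α - β) = a ^ 2 - b ^ 2 ∧
      4 * dl ℂ α = 4 * α ^ 2 + b ^ 2 * (a ^ 2 - b ^ 2) := by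
  have ha : PowerSeries.constantCoeff a ≠ 0 := by
    rw [← PowerSeries.coeff_zero_eq_constantCoeff_apply, ha0]; exact one_ne_zero
  have hb : PowerSeries.constantCoeff b ≠ 0 := by
    rw [← PowerSeries.coeff_zero_eq_constantCoeff_apply, hb0]; exact one_ne_zero
  have hane : a ≠ 0 := by rintro rfl; simp at ha
  have hbne : b ≠ 0 := by rintro rfl; simp at hb
  obtain ⟨α, eα⟩ : ∃ α, dl ℂ a = a * α :=
    ⟨a⁻¹ * dl ℂ a, by rw [← mul_assoc, PowerSeries.mul_inv_cancel _ ha, one_mul]⟩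
  obtain ⟨β, eβ⟩ : ∃ β, dl ℂ b = b * β :=
    ⟨b⁻¹ * dl ℂ b, by rw [← mul_assoc, PowerSeries.mul_inv_cancel _ hb, one_mul]⟩
  have hd2 : dl ℂ (2 : PowerSeries ℂ) = 0 := by
    have := (dl ℂ).map_natCast 2
    simpa using this
  -- values at q²
  have e1 : dl ℂ a + dl ℂ b = 4 * sg (dl ℂ a) := by
    have := congrArg (dl ℂ) h1
    rw [map_add, dl_mul, hd2, dl_sg] at this
    linear_combination this
  have e2 : a * dl ℂ b + b * dl ℂ a = 4 * (sg b * sg (dl ℂ b)) := by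
    have := congrArg (dl ℂ) h2
    rw [dl_mul, sq, dl_mul, dl_sg] at this
    linear_combination this
  have hsum : a + b ≠ 0 := by
    intro h
    have := congrArg (PowerSeries.coeff 0) h
    rw [map_add, ha0, hb0, map_zero] at this
    norm_num at this
  have e3 : 2 * ((a + b) * sg α) = a * α + b * β := by
    rw [eα, eβ, map_mul] at e1
    linear_combination (2 * sg α) * h1 - e1
  have e4 : 4 * sg β = α + β := by
    rw [eα, eβ, map_mul] at e2
    have : (a * b) * (4 * sg β) = (a * b) * (α + β) := by
      linear_combination (4 * sg β) * h2 - e2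
    exact mul_left_cancel₀ (mul_ne_zero hane hbne) this
  set f := 2 * (α - β) - (a ^ 2 - b ^ 2) with hf
  have hsf : 4 * ((a + b) * sg f) = (a - b) * f := by
    have : sg f = 2 * (sg α - sg β) - (sg a ^ 2 - sg b ^ 2) := by
      rw [hf]
      simp only [map_sub, map_mul, map_pow]
      rw [map_ofNat sg 2]
    have h1' : 4 * sg a ^ 2 = (a + b) ^ 2 := by rw [h1]; ring
    rw [this, hf]
    linear_combination 4 * e3 - 2 * (a + b) * e4 - (a + b) * h1' - 4 * (a + b) * h2
  have cα : PowerSeries.coeff 0 α = 0 ∧ PowerSeries.coeff 1 α = 4 := by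
    have k0 := congrArg (PowerSeries.coeff 0) eα
    have k1 := congrArg (PowerSeries.coeff 1) eα
    rw [coeff_dl, coeff_zero_mul_ps, ha0] at k0
    rw [coeff_dl, PowerSeries.coeff_one_mul, ha1, ← PowerSeries.coeff_zero_eq_constantCoeff_apply,
      ← PowerSeries.coeff_zero_eq_constantCoeff_apply, ha0] at k1
    have k0' : PowerSeries.coeff 0 α = 0 := by simpa using k0.symm
    rw [k0'] at k1
    exact ⟨k0', by simpa using k1.symm⟩
  have cβ : PowerSeries.coeff 0 β = 0 ∧ PowerSeries.coeff 1 β = -4 := by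
    have k0 := congrArg (PowerSeries.coeff 0) eβ
    have k1 := congrArg (PowerSeries.coeff 1) eβ
    rw [coeff_dl, coeff_zero_mul_ps, hb0] at k0
    rw [coeff_dl, PowerSeries.coeff_one_mul, hb1, ← PowerSeries.coeff_zero_eq_constantCoeff_apply,
      ← PowerSeries.coeff_zero_eq_constantCoeff_apply, hb0] at k1
    have k0' : PowerSeries.coeff 0 β = 0 := by simpa using k0.symm
    rw [k0'] at k1
    exact ⟨k0', by simpa using k1.symm⟩
  have f2C : (2 : PowerSeries ℂ) = PowerSeries.C 2 := (map_ofNat PowerSeries.C 2).symm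
  have hf0 : PowerSeries.coeff 0 f = 0 := by
    rw [hf, f2C]
    simp only [map_sub, PowerSeries.coeff_C_mul, sq, coeff_zero_mul_ps, ha0, hb0, cα.1, cβ.1]
    ring
  have hf1 : PowerSeries.coeff 1 f = 0 := by
    rw [hf, f2C]
    simp only [map_sub, PowerSeries.coeff_C_mul, sq, PowerSeries.coeff_one_mul, ha0, hb0, cα.2, cβ.2,
      ← PowerSeries.coeff_zero_eq_constantCoeff_apply, ha1, hb1]
    norm_num
  have hX2 : PowerSeries.X ^ 2 ∣ f := by
    rw [PowerSeries.X_pow_dvd_iff]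
    intro m hm
    interval_cases m
    · exact hf0
    · exact hf1
  have hstep : ∀ n : ℕ, PowerSeries.X ^ (n + 2) ∣ f := by
    intro n
    induction n with
    | zero => exact hX2
    | succ n ih =>
      obtain ⟨r, hr⟩ := ih
      have hab : PowerSeries.X ∣ a - b := by
        rw [PowerSeries.X_dvd_iff, map_sub, ← PowerSeries.coeff_zero_eq_constantCoeff_apply,
          ← PowerSeries.coeff_zero_eq_constantCoeff_apply, ha0, hb0, sub_self]
      obtain ⟨d, hd⟩ := hab
      have hd0 : PowerSeries.constantCoeff d = 8 := by
        have := congrArg (PowerSeries.coeff 1) hd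
        rw [map_sub, ha1, hb1, show (1 : ℕ) = 0 + 1 from rfl, PowerSeries.coeff_succ_X_mul] at this
        rw [← PowerSeries.coeff_zero_eq_constantCoeff_apply]
        rw [← this]; norm_num
      rw [hr, map_mul, map_pow, sg_X, hd] at hsf
      have h3 : (PowerSeries.X : PowerSeries ℂ) ^ (n + 3) * (d * r) =
          PowerSeries.X ^ (n + 3) * (PowerSeries.X * (PowerSeries.X ^ n * (4 * ((a + b) * sg r)))) := by
        linear_combination -hsf
      have h4 := mul_left_cancel₀ (pow_ne_zero _ PowerSeries.X_ne_zero) h3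
      have h5 := congrArg PowerSeries.constantCoeff h4
      rw [map_mul, map_mul, PowerSeries.constantCoeff_X, zero_mul, hd0] at h5
      have h6 : PowerSeries.constantCoeff r = 0 := by simpa using h5
      obtain ⟨s, hs⟩ := PowerSeries.X_dvd_iff.2 h6
      exact ⟨s, by rw [hr, hs]; ring⟩
  have hfz : f = 0 := by
    refine eq_zero_of_X_pow_dvd f fun n => ?_
    exact (pow_dvd_pow _ (by omega)).trans (hstep n)
  have hf' : 2 * (α - β) = a ^ 2 - b ^ 2 := sub_eq_zero.1 hfz
  refine ⟨α, β, eα, eβ, hf', ?_⟩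
  set g := 4 * dl ℂ α - (4 * α ^ 2 + b ^ 2 * (a ^ 2 - b ^ 2)) with hg
  have hg4 : 4 * sg g = g := by
    have e5 : 4 * sg α = 2 * α - b * (a - b) := by
      apply mul_left_cancel₀ hsum
      linear_combination 2 * e3 - b * hf'
    have e6 := congrArg (dl ℂ) e5
    have hd4 : dl ℂ (4 : PowerSeries ℂ) = 0 := by
      have := (dl ℂ).map_natCast 4
      simpa using this
    rw [dl_mul, hd4, dl_sg, map_sub, dl_mul, hd2, dl_mul, map_sub, eα, eβ] at e6
    have : sg g = 4 * sg (dl ℂ α) - (4 * sg α ^ 2 + sg b ^ 2 * (sg a ^ 2 - sg b ^ 2)) := by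
      rw [hg]
      simp only [map_sub, map_mul, map_pow, map_add]
      rw [map_ofNat sg 4]
    have h1' : 4 * sg a ^ 2 = (a + b) ^ 2 := by rw [h1]; ring
    have e5' : 16 * sg α ^ 2 = (2 * α - b * (a - b)) ^ 2 := by rw [← e5]; ring
    have h2' : 4 * (sg b ^ 2 * (sg a ^ 2 - sg b ^ 2)) = a * b * ((a + b) ^ 2 - 4 * (a * b)) := by
      rw [← h1', h2]; ring
    rw [this, hg]
    linear_combination 2 * e6 - e5' - h2' + b * (a - 2 * b) * hf'
  have hgz : g = 0 := by
    refine eq_zero_of_X_pow_dvd g fun n => ?_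
    induction n with
    | zero => simp
    | succ n ih =>
      obtain ⟨r, hr⟩ := ih
      rcases Nat.eq_zero_or_pos n with rfl | hn
      · rw [zero_add, pow_one, PowerSeries.X_dvd_iff]
        have := congrArg PowerSeries.constantCoeff hg4
        rw [map_mul, sg, PowerSeries.constantCoeff_expand, map_ofNat PowerSeries.constantCoeff 4] at this
        linear_combination (1 / 3 : ℂ) * this
      · rw [← hg4, hr, map_mul, map_pow, sg_X, ← pow_mul]
        exact Dvd.dvd.mul_left (Dvd.dvd.mul_right (pow_dvd_pow _ (by omega)) _) _
  exact sub_eq_zero.1 hgz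

lemma exists_XYS : ∃ X Y S : PowerSeries ℂ, QRep xx (-X) ∧ QRep yy Y ∧
    PowerSeries.constantCoeff X = 1 ∧ PowerSeries.constantCoeff Y = 0 ∧
    PowerSeries.coeff 1 Y = 16 ∧ PowerSeries.constantCoeff S = 0 ∧
    dl ℂ X = X * (2 * S - Y) ∧ dl ℂ Y = Y * (X + 2 * S) ∧
    4 * dl ℂ S = 4 * S ^ 2 + X * Y := by
  set A := thetaPS fun _ => 1 with hA
  set B := thetaPS fun n => (-1) ^ n with hB
  have rA : QRep theta3 A := rep_theta3
  have rB : QRep theta4 B := rep_theta4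
  have A0 : PowerSeries.coeff 0 A = 1 := by rw [hA, thetaPS_coeff_zero]
  have A1 : PowerSeries.coeff 1 A = 2 := by rw [hA, thetaPS_coeff_one]; norm_num
  have B0 : PowerSeries.coeff 0 B = 1 := by rw [hB, thetaPS_coeff_zero]; norm_num
  have B1 : PowerSeries.coeff 1 B = -2 := by rw [hB, thetaPS_coeff_one]; norm_num
  have hp1 : ∀ f : PowerSeries ℂ, PowerSeries.coeff 0 (f ^ 2) = PowerSeries.coeff 0 f ^ 2 := by
    intro f; simp
  have hp2 : ∀ f : PowerSeries ℂ, PowerSeries.coeff 1 (f ^ 2) =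
      2 * PowerSeries.coeff 0 f * PowerSeries.coeff 1 f := by
    intro f
    rw [sq, PowerSeries.coeff_one_mul, PowerSeries.coeff_zero_eq_constantCoeff_apply]
    ring
  have h1 : A ^ 2 + B ^ 2 = 2 * sg (A ^ 2) := by
    have l := (rA.pow 2).add (rB.pow 2)
    have r := (QRep.const 2).mul ((rA.pow 2).expand)
    refine (l.congr ?_).unique (r.congr (g := fun τ => 2 * theta3 (2 * τ) ^ 2) ?_) |>.trans ?_
    · intro τ hτ; exact theta_T1 hτ
    · intro τ hτ; rfl
    · rw [map_ofNat PowerSeries.C 2]; rfl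
  have h2 : A ^ 2 * B ^ 2 = sg (B ^ 2) ^ 2 := by
    have l := (rA.pow 2).mul (rB.pow 2)
    have r := ((rB.pow 2).expand).pow 2
    refine (l.congr ?_).unique r
    intro τ hτ
    show theta3 τ ^ 2 * theta4 τ ^ 2 = (theta4 (2 * τ) ^ 2) ^ 2
    rw [← theta_T2 hτ]; ring
  obtain ⟨α, β, eα, eβ, e1, e2⟩ := theta_ode_formal (A ^ 2) (B ^ 2) h1 h2
    (by rw [hp1, A0]; norm_num) (by rw [hp1, B0]; norm_num)
    (by rw [hp2, A0, A1]; norm_num) (by rw [hp2, B0, B1]; norm_num)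
  have hX0 : PowerSeries.constantCoeff ((B ^ 2) ^ 2) = 1 := by
    rw [← PowerSeries.coeff_zero_eq_constantCoeff_apply, hp1, hp1, B0]; norm_num
  have hY0 : PowerSeries.constantCoeff ((A ^ 2) ^ 2 - (B ^ 2) ^ 2) = 0 := by
    rw [map_sub, hX0, ← PowerSeries.coeff_zero_eq_constantCoeff_apply, hp1, hp1, A0]; norm_num
  refine ⟨(B ^ 2) ^ 2, (A ^ 2) ^ 2 - (B ^ 2) ^ 2, α, ?_, ?_, hX0, hY0, ?_, ?_, ?_, ?_, e2⟩
  · have := (QRep.const 0).sub (rB.pow 4)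
    have h := this.congr (g := xx) (fun τ hτ => by simp [xx])
    convert h using 1
    rw [map_zero]; ring
  · have := (rA.pow 4).sub (rB.pow 4)
    have h := this.congr (g := yy) (fun τ hτ => by simp only [yy]; exact (theta_T3 hτ).symm)
    convert h using 1
    ring
  · rw [map_sub, hp2, hp1, hp2, hp2, hp1, hp2, A0, A1, B0, B1]; norm_num
  · have := congrArg PowerSeries.constantCoeff e2
    rw [map_mul, map_add, map_mul, map_mul, hY0, map_pow,
      ← PowerSeries.coeff_zero_eq_constantCoeff_apply, ← PowerSeries.coeff_zero_eq_constantCoeff_apply,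
      coeff_dl] at this
    rw [PowerSeries.coeff_zero_eq_constantCoeff_apply, map_ofNat PowerSeries.constantCoeff 4] at this
    simpa using this
  · rw [sq (B ^ 2), dl_mul, eβ]
    linear_combination (-(B ^ 4)) * e1
  · rw [map_sub, sq (B ^ 2), dl_mul, eβ, sq (A ^ 2), dl_mul, eα]
    linear_combination (B ^ 4) * e1

/-- Power series in `q` with coefficients polynomials in `t`. -/
abbrev RR := PowerSeries (Polynomial ℂ)

/-- The embedding of `ℂ⟦q⟧`. -/
def iot : PowerSeries ℂ →+* RR := PowerSeries.map Polynomial.C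

/-- Evaluation at `t = 0`. -/
def ez : RR →+* PowerSeries ℂ := PowerSeries.map (Polynomial.evalRingHom 0)

/-- The Euler derivation as an additive map. -/
def dla (R : Type*) [CommRing R] : PowerSeries R →+ PowerSeries R :=
  (dl R).toLinearMap.toAddMonoidHom

lemma dla_mul {R : Type*} [CommRing R] (f g : PowerSeries R) :
    dla R (f * g) = f * dla R g + g * dla R f := dl_mul f g

lemma coeff_dla {R : Type*} [CommRing R] (f : PowerSeries R) (n : ℕ) :
    PowerSeries.coeff n (dla R f) = n * PowerSeries.coeff n f := coeff_dl f n

lemma dla_X {R : Type*} [CommRing R] : dla R (PowerSeries.X) = PowerSeries.X := dl_X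

lemma ez_iot (f : PowerSeries ℂ) : ez (iot f) = f := by
  ext n
  simp [ez, iot]

lemma coeff_iot (f : PowerSeries ℂ) (n : ℕ) :
    PowerSeries.coeff n (iot f) = Polynomial.C (PowerSeries.coeff n f) := by
  simp [iot]

lemma constantCoeff_iot (f : PowerSeries ℂ) :
    PowerSeries.constantCoeff (iot f) = Polynomial.C (PowerSeries.constantCoeff f) := by
  rw [← PowerSeries.coeff_zero_eq_constantCoeff_apply, coeff_iot,
    PowerSeries.coeff_zero_eq_constantCoeff_apply]

lemma iot_X : iot PowerSeries.X = PowerSeries.X := by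
  simp [iot]

lemma ez_C (p : Polynomial ℂ) : ez (PowerSeries.C p) = PowerSeries.C (p.eval 0) := by
  simp [ez]

lemma ez_X : ez PowerSeries.X = PowerSeries.X := by
  simp [ez]

/-- Coefficientwise derivative in `t`. -/
def dt : RR →+ RR where
  toFun f := PowerSeries.mk fun n => Polynomial.derivative (PowerSeries.coeff n f)
  map_zero' := by ext n; simp
  map_add' f g := by
    ext n : 1
    simp

lemma coeff_dt (f : RR) (n : ℕ) :
    PowerSeries.coeff n (dt f) = Polynomial.derivative (PowerSeries.coeff n f) := by
  exact PowerSeries.coeff_mk n (fun n => Polynomial.derivative (PowerSeries.coeff n f))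

lemma dt_mul (f g : RR) : dt (f * g) = f * dt g + g * dt f := by
  ext n : 1
  rw [coeff_dt, mul_comm g, map_add, PowerSeries.coeff_mul, PowerSeries.coeff_mul,
    PowerSeries.coeff_mul, Polynomial.derivative_sum, ← Finset.sum_add_distrib]
  refine Finset.sum_congr rfl fun p _ => ?_
  rw [Polynomial.derivative_mul, coeff_dt, coeff_dt]
  ring

lemma dt_C (p : Polynomial ℂ) : dt (PowerSeries.C p) = PowerSeries.C (Polynomial.derivative p) := by
  ext n : 1
  rw [coeff_dt, PowerSeries.coeff_C, PowerSeries.coeff_C]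
  split_ifs <;> simp

lemma dt_iot (f : PowerSeries ℂ) : dt (iot f) = 0 := by
  ext n : 1
  rw [coeff_dt, coeff_iot, Polynomial.derivative_C, map_zero]

/-- The Euler derivation of `RR`. -/
def dq : RR →+ RR := dla (Polynomial ℂ)

lemma dq_mul (f g : RR) : dq (f * g) = f * dq g + g * dq f := dla_mul f g

lemma coeff_dq (f : RR) (n : ℕ) :
    PowerSeries.coeff n (dq f) = n * PowerSeries.coeff n f := coeff_dla f n

lemma dq_iot (f : PowerSeries ℂ) : dq (iot f) = iot (dl ℂ f) := by
  ext n : 1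
  rw [coeff_dq, coeff_iot, coeff_iot, coeff_dl]
  simp

lemma dq_C (p : Polynomial ℂ) : dq (PowerSeries.C p) = 0 := by
  ext n : 1
  rw [coeff_dq, PowerSeries.coeff_C]
  split_ifs with h
  · simp [h]
  · simp

/-- Good derivations of `RR`. -/
structure GoodD (D : RR →+ RR) : Prop where
  mul : ∀ f g, D (f * g) = f * D g + g * D f
  const : ∀ z : ℂ, D (PowerSeries.C (Polynomial.C z)) = 0
  dvd : ∀ (n : ℕ) (f : RR), PowerSeries.X ^ n ∣ f → PowerSeries.X ^ n ∣ D f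

lemma good_dt : GoodD dt where
  mul := dt_mul
  const z := by rw [dt_C]; simp
  dvd n f h := by
    rw [PowerSeries.X_pow_dvd_iff] at h ⊢
    intro m hm
    rw [coeff_dt, h m hm, map_zero]

lemma good_dq : GoodD dq where
  mul := dq_mul
  const z := dq_C _
  dvd n f h := by
    rw [PowerSeries.X_pow_dvd_iff] at h ⊢
    intro m hm
    rw [coeff_dq, h m hm, mul_zero]

lemma GoodD.one {D : RR →+ RR} (h : GoodD D) : D 1 = 0 := by
  have := h.const 1
  simpa using this

lemma GoodD.pow {D : RR →+ RR} (h : GoodD D) {f l : RR} (hf : D f = f * l) (n : ℕ) :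
    D (f ^ n) = f ^ n * (n * l) := by
  induction n with
  | zero => simp [h.one]
  | succ n ih =>
    rw [pow_succ, h.mul, ih, hf]
    push_cast
    ring

/-- Truncated exponential. -/
def expT (g : RR) (M : ℕ) : RR :=
  ∑ j ∈ Finset.range M, PowerSeries.C (Polynomial.C ((1 : ℂ) / (j.factorial : ℂ))) * g ^ j

lemma GoodD.pow_succ' {D : RR →+ RR} (h : GoodD D) (f : RR) (n : ℕ) :
    D (f ^ (n + 1)) = (n + 1 : ℕ) * f ^ n * D f := by
  induction n with
  | zero => simp
  | succ n ih =>
    rw [pow_succ, h.mul, ih]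
    push_cast
    ring

lemma D_expT {D : RR →+ RR} (h : GoodD D) (g : RR) (M : ℕ) :
    D (expT g (M + 1)) = expT g M * D g := by
  induction M with
  | zero =>
    simp [expT, h.one]
  | succ M ih =>
    have e : expT g (M + 1 + 1) = expT g (M + 1) +
        PowerSeries.C (Polynomial.C ((1 : ℂ) / ((M + 1).factorial : ℂ))) * g ^ (M + 1) := by
      rw [expT, Finset.sum_range_succ, ← expT]
    have e' : expT g (M + 1) = expT g M +
        PowerSeries.C (Polynomial.C ((1 : ℂ) / (M.factorial : ℂ))) * g ^ M := by
      rw [expT, Finset.sum_range_succ, ← expT]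
    have key : PowerSeries.C (Polynomial.C ((1 : ℂ) / ((M + 1).factorial : ℂ))) * ((M + 1 : ℕ) : RR)
        = PowerSeries.C (Polynomial.C ((1 : ℂ) / (M.factorial : ℂ))) := by
      have h1 : ((M + 1 : ℕ) : RR) = PowerSeries.C (Polynomial.C ((M + 1 : ℕ) : ℂ)) := by
        rw [map_natCast, map_natCast]
      rw [h1, ← map_mul, ← map_mul]
      congr 2
      rw [Nat.factorial_succ]
      have : (M.factorial : ℂ) ≠ 0 := by exact_mod_cast M.factorial_ne_zero
      have : ((M + 1 : ℕ) : ℂ) ≠ 0 := by exact_mod_cast M.succ_ne_zero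
      push_cast at *
      field_simp
    rw [e, map_add, ih, h.mul, h.const, h.pow_succ', e']
    linear_combination (g ^ M * D g) * key

lemma exists_exp (g : RR) (hg : PowerSeries.constantCoeff g = 0) :
    ∃ V : RR, PowerSeries.constantCoeff V = 1 ∧ (ez g = 0 → ez V = 1) ∧
      ∀ D : RR →+ RR, GoodD D → D V = V * D g := by
  set V : RR := PowerSeries.mk fun n => PowerSeries.coeff n (expT g (n + 1)) with hV
  have hgd : ∀ j, PowerSeries.X ^ j ∣ g ^ j := fun j => pow_dvd_pow_of_dvd (PowerSeries.X_dvd_iff.2 hg) j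
  have hcong : ∀ n M, n < M → PowerSeries.coeff n (expT g M) = PowerSeries.coeff n (expT g (n + 1)) := by
    intro n M hM
    induction M with
    | zero => omega
    | succ M ih =>
      rcases Nat.lt_or_ge n M with h | h
      · rw [← ih h, expT, Finset.sum_range_succ, ← expT, map_add, PowerSeries.coeff_C_mul,
          PowerSeries.X_pow_dvd_iff.1 (hgd M) n h, mul_zero, add_zero]
      · have : n = M := by omega
        rw [this]
  have hVd : ∀ M, PowerSeries.X ^ M ∣ V - expT g M := by
    intro M
    rw [PowerSeries.X_pow_dvd_iff]
    intro n hn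
    rw [map_sub, hV, PowerSeries.coeff_mk, hcong n M hn, sub_self]
  refine ⟨V, ?_, ?_, ?_⟩
  · rw [← PowerSeries.coeff_zero_eq_constantCoeff_apply, hV, PowerSeries.coeff_mk]
    simp [expT]
  · intro h0
    have hE : ∀ M, ez (expT g (M + 1)) = 1 := by
      intro M
      rw [expT, map_sum, Finset.sum_range_succ']
      simp [h0]
    have h1 : ez V - 1 = 0 := by
      refine eq_zero_of_X_pow_dvd _ fun n => ?_
      obtain ⟨r, hr⟩ := hVd (n + 1)
      have := congrArg ez hr
      rw [map_sub, hE n, map_mul, map_pow, ez_X] at this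
      rw [this, pow_succ, mul_assoc]
      exact dvd_mul_right _ _
    exact sub_eq_zero.1 h1
  · intro D hD
    rw [← sub_eq_zero]
    refine eq_zero_of_X_pow_dvd _ fun n => ?_
    have e : D V - V * D g = D (V - expT g (n + 1)) - (V - expT g n) * D g := by
      rw [map_sub, D_expT hD]; ring
    rw [e]
    refine dvd_sub ?_ (Dvd.dvd.mul_right (hVd n) _)
    exact (pow_dvd_pow _ (by omega)).trans (hD.dvd _ _ (hVd (n + 1)))

/-- The polynomial `4 r_m` of the recursion. -/
def rho (n k : ℕ) (m : ℕ) (φ : Polynomial ℂ) : Polynomial ℂ :=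
  (Polynomial.X ^ 2 - 4 * Polynomial.X) * (Polynomial.derivative φ + (n : Polynomial ℂ) * φ) + 4 * (m : Polynomial ℂ) * φ
    - (k : Polynomial ℂ) * (4 - 2 * Polynomial.X) * φ

/-- The main first order operator (times four). -/
def TT (X Y : RR) (n k m : ℕ) (G : RR) : RR :=
  (4 * X + 4 * PowerSeries.C Polynomial.X * Y - PowerSeries.C Polynomial.X ^ 2 * Y) * (dt G + (n : RR) * G)
    - 4 * dq G - 4 * (m : RR) * (X + Y) * G + (k : RR) * (4 * Y - 2 * PowerSeries.C Polynomial.X * Y) * G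

lemma TT_base (X Y S : PowerSeries ℂ)
    (hX0 : PowerSeries.constantCoeff X = 1)
    (hS0 : PowerSeries.constantCoeff S = 0)
    (dX : dl ℂ X = X * (2 * S - Y))
    (dS : 4 * dl ℂ S = 4 * S ^ 2 + X * Y) :
    ∃ V J : RR, PowerSeries.constantCoeff V = 1 ∧ PowerSeries.constantCoeff J = 1 ∧
      ez V = 1 ∧ X * ez J = 1 ∧
      ∀ n k : ℕ, TT (iot X) (iot Y) n k 0 (PowerSeries.X ^ n * V ^ n * J ^ k) = 0 := by
  set t : RR := PowerSeries.C Polynomial.X with ht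
  have hdtt : dt t = 1 := by rw [ht, dt_C, Polynomial.derivative_X, map_one]
  have hdqt : dq t = 0 := dq_C _
  have hW0 : PowerSeries.constantCoeff (iot X + t * iot S) = 1 := by
    rw [map_add, map_mul, constantCoeff_iot, constantCoeff_iot, hX0, hS0]; simp
  obtain ⟨I, hI⟩ : ∃ I, (iot X + t * iot S) * I = 1 :=
    ⟨PowerSeries.invOfUnit _ 1, PowerSeries.mul_invOfUnit _ 1 (by simpa using hW0)⟩
  have hI0 : PowerSeries.constantCoeff I = 1 := by
    have := congrArg PowerSeries.constantCoeff hI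
    rw [map_mul, hW0, one_mul, map_one] at this
    exact this
  have ezt : ez t = 0 := by rw [ht, ez_C]; simp
  have ezI : X * ez I = 1 := by
    have := congrArg ez hI
    rw [map_mul, map_add, map_mul, ez_iot, ezt, map_one] at this
    simpa using this
  obtain ⟨V, hV0, hVe, hVD⟩ := exists_exp (t * I - t) (by rw [map_sub, map_mul, hI0]; simp)
  have dXR : dq (iot X) = iot X * (2 * iot S - iot Y) := by
    rw [dq_iot, dX, map_mul, map_sub, map_mul, map_ofNat iot 2]
  have dSR : 4 * dq (iot S) = 4 * iot S ^ 2 + iot X * iot Y := by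
    rw [dq_iot]
    have := congrArg iot dS
    rw [map_add, map_mul, map_mul, map_mul, map_pow, map_ofNat iot 4] at this
    exact this
  have tI : dt I = -(I ^ 2 * iot S) := by
    have := congrArg dt hI
    rw [dt_mul, map_add, dt_mul, dt_iot, dt_iot, hdtt, good_dt.one] at this
    linear_combination I * this - (dt I) * hI
  have qI : dq I = -(I ^ 2 * (dq (iot X) + t * dq (iot S))) := by
    have := congrArg dq hI
    rw [dq_mul, map_add, dq_mul, hdqt, good_dq.one] at this
    linear_combination I * this - (dq I) * hI
  have tV := hVD dt good_dt
  have qV := hVD dq good_dq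
  rw [map_sub, dt_mul, tI, hdtt] at tV
  rw [map_sub, dq_mul, qI, hdqt] at qV
  have tJ : dt (iot X * I ^ 2) = (iot X * I ^ 2) * (-2 * iot S * I) := by
    rw [dt_mul, dt_iot, sq, dt_mul, tI]; ring
  have qJ : dq (iot X * I ^ 2) = (iot X * I ^ 2) *
      ((2 * iot S - iot Y) - 2 * I * (dq (iot X) + t * dq (iot S))) := by
    rw [dq_mul, sq, dq_mul, qI]
    linear_combination (I * I) * dXR
  refine ⟨V, iot X * I ^ 2, hV0, ?_, ?_, ?_, ?_⟩
  · rw [map_mul, map_pow, hI0, constantCoeff_iot, hX0]; simp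
  · apply hVe
    rw [map_sub, map_mul, ezt]; ring
  · rw [map_mul, map_pow, ez_iot]
    linear_combination (X * ez I + 1) * ezI
  · intro n k
    have qq : dq (PowerSeries.X ^ n) = PowerSeries.X ^ n * ((n : RR) * 1) :=
      good_dq.pow (by rw [mul_one]; exact dla_X) n
    have tq : dt (PowerSeries.X ^ n) = 0 := by
      rw [← iot_X, ← map_pow]; exact dt_iot _
    have tVn := good_dt.pow tV n
    have qVn := good_dq.pow qV n
    have tJn := good_dt.pow tJ k
    have qJn := good_dq.pow qJ k
    rw [TT, ← ht, dt_mul, dt_mul, dq_mul, dq_mul, tVn, qVn, tJn, qJn, qq, tq]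
    generalize (iot X * I ^ 2) ^ k = Jk
    generalize V ^ n = Vn
    generalize (PowerSeries.X : RR) ^ n = qn
    clear tVn qVn tJn qJn qq tq tV qV tJ qJ qI tI
    generalize dq (iot X) = dx at *
    generalize dq (iot S) = ds at *
    subst dXR
    generalize iot X = x at *
    generalize iot Y = y at *
    generalize iot S = s at *
    have k1 : (4 * x + 4 * t * y - t ^ 2 * y) * (I - t * I ^ 2 * s) - 4 +
        4 * t * (I ^ 2 * (x * (2 * s - y) + t * ds)) = 0 := by
      linear_combination (-(4 * x + 4 * t * y - t ^ 2 * y) * I + 4 * ((x + t * s) * I + 1)) * hI + t ^ 2 * I ^ 2 * dSR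
    have k2 : (4 * x + 4 * t * y - t ^ 2 * y) * (-2 * s * I) - 4 * ((2 * s - y) -
        2 * I * (x * (2 * s - y) + t * ds)) + (4 * y - 2 * t * y) = 0 := by
      linear_combination (8 * s - 8 * y + 2 * t * y) * hI + 2 * I * t * dSR
    push_cast
    linear_combination (qn * Vn * Jk * (n : RR)) * k1 + (qn * Vn * Jk * (k : RR)) * k2

/-- One step of the `u`-adic expansion. -/
def nextF (W : RR) (F : RR) : RR := (PowerSeries.mk fun p => PowerSeries.coeff (p + 1) F) * W

/-- The iterated `u`-adic remainders. -/
def seqF (W : RR) (F : RR) : ℕ → RR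
  | 0 => F
  | m + 1 => nextF W (seqF W F m)

lemma nextF_spec (U W F : RR) (h : U * W = 1) :
    F = PowerSeries.C (PowerSeries.constantCoeff F) + PowerSeries.X * U * nextF W F := by
  conv_lhs => rw [PowerSeries.eq_X_mul_shift_add_const F]
  rw [nextF]
  linear_combination (-PowerSeries.X * (PowerSeries.mk fun p => PowerSeries.coeff (p + 1) F)) * h

lemma nextF_X_mul (W F : RR) : nextF W (PowerSeries.X * F) = F * W := by
  rw [nextF]
  congr 1
  ext n : 1
  rw [PowerSeries.coeff_mk, PowerSeries.coeff_succ_X_mul]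

lemma seqF_eq (W A : RR) (n : ℕ) : ∀ m : ℕ, m ≤ n →
    seqF W (PowerSeries.X ^ n * A) m = PowerSeries.X ^ (n - m) * A * W ^ m := by
  intro m
  induction m with
  | zero => intro _; simp [seqF]
  | succ m ih =>
    intro h
    rw [seqF, ih (by omega)]
    have : n - m = (n - (m + 1)) + 1 := by omega
    rw [this, pow_succ, pow_succ, mul_comm (PowerSeries.X ^ (n - (m + 1))) PowerSeries.X, mul_assoc,
      mul_assoc, nextF_X_mul]
    ring

lemma TT_u (X Y u : RR) (hu : dq u = u * (X + Y)) (tu : dt u = 0) (n k m : ℕ) (G : RR) :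
    TT X Y n k m (u * G) = u * TT X Y n k (m + 1) G := by
  rw [TT, TT, dt_mul, dq_mul, hu, tu]
  push_cast
  ring

lemma TT_add (X Y : RR) (n k m : ℕ) (F G : RR) :
    TT X Y n k m (F + G) = TT X Y n k m F + TT X Y n k m G := by
  rw [TT, TT, TT, map_add, map_add]
  ring

lemma TT_C (X Y u : RR) (hu : X * u = -Y) (n k m : ℕ) (φ : Polynomial ℂ) :
    TT X Y n k m (PowerSeries.C φ) =
      X * (PowerSeries.C (4 * (Polynomial.derivative φ + (n : Polynomial ℂ) * φ
        - (m : Polynomial ℂ) * φ)) + u * PowerSeries.C (rho n k m φ)) := by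
  rw [TT, dt_C, dq_C, rho]
  have hY : Y = -(X * u) := by rw [hu]; ring
  rw [hY]
  simp only [map_add, map_sub, map_mul, map_pow, map_natCast]
  rw [map_ofNat (PowerSeries.C : Polynomial ℂ →+* RR) 4,
    map_ofNat (PowerSeries.C : Polynomial ℂ →+* RR) 2]
  ring

lemma phi_exists (X Y S u U : PowerSeries ℂ)
    (hX0 : PowerSeries.constantCoeff X = 1)
    (hS0 : PowerSeries.constantCoeff S = 0)
    (dX : dl ℂ X = X * (2 * S - Y)) (dY : dl ℂ Y = Y * (X + 2 * S))
    (dS : 4 * dl ℂ S = 4 * S ^ 2 + X * Y)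
    (hu : X * u = -Y) (huU : u = PowerSeries.X * U)
    (hU0 : PowerSeries.constantCoeff U = -16) (n k : ℕ) :
    ∃ (φ : ℕ → Polynomial ℂ) (G : ℕ → PowerSeries ℂ),
      (Polynomial.derivative (φ 0) + (n : Polynomial ℂ) * φ 0 = 0) ∧
      (∀ m : ℕ, 4 * (Polynomial.derivative (φ (m + 1)) + (n : Polynomial ℂ) * φ (m + 1)
        - ((m + 1 : ℕ) : Polynomial ℂ) * φ (m + 1)) + rho n k m (φ m) = 0) ∧
      (∀ m < n, φ m = 0) ∧ φ n = Polynomial.C ((-1 / 16) ^ n) ∧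
      X ^ k * G 0 = PowerSeries.X ^ n ∧
      ∀ m, G m = PowerSeries.C ((φ m).eval 0) + u * G (m + 1) := by
  obtain ⟨V, J, hV0, hJ0, ezV, ezJ, hT⟩ := TT_base X Y S hX0 hS0 dX dS
  have hT := hT n k
  have hUne : PowerSeries.constantCoeff U ≠ 0 := by rw [hU0]; norm_num
  set W := U⁻¹ with hW
  have hUW : U * W = 1 := PowerSeries.mul_inv_cancel _ hUne
  have hW0 : PowerSeries.constantCoeff W = -1 / 16 := by
    have := congrArg PowerSeries.constantCoeff hUW
    rw [map_mul, hU0, map_one] at this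
    linear_combination (-1 / 16 : ℂ) * this
  have hUWR : iot U * iot W = 1 := by rw [← map_mul, hUW, map_one]
  have hXne : X ≠ 0 := by rintro rfl; simp at hX0
  have hUne' : U ≠ 0 := by rintro rfl; simp at hUne
  have hune : u ≠ 0 := by rw [huU]; exact mul_ne_zero PowerSeries.X_ne_zero hUne'
  have du : dl ℂ u = u * (X + Y) := by
    apply mul_left_cancel₀ hXne
    have := congrArg (dl ℂ) hu
    rw [dl_mul, map_neg, dX, dY] at this
    linear_combination this - (X + 2 * S) * hu
  have duR : dq (iot u) = iot u * (iot X + iot Y) := by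
    rw [dq_iot, du, map_mul, map_add]
  have huR : iot X * iot u = -iot Y := by rw [← map_mul, hu, map_neg]
  have huUR : iot u = PowerSeries.X * iot U := by rw [huU, map_mul, iot_X]
  have huneR : iot u ≠ 0 := by
    intro h
    have := congrArg ez h
    rw [ez_iot, map_zero] at this
    exact hune this
  have hu0 : PowerSeries.constantCoeff (iot u) = 0 := by
    rw [huUR, map_mul]; simp
  have hX0R : PowerSeries.constantCoeff (iot X) = 1 := by rw [constantCoeff_iot, hX0, map_one]
  set F := seqF (iot W) (PowerSeries.X ^ n * (V ^ n * J ^ k)) with hF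
  set φ : ℕ → Polynomial ℂ := fun m => PowerSeries.constantCoeff (F m) with hφ
  have hstep : ∀ m, F m = PowerSeries.C (φ m) + iot u * F (m + 1) := by
    intro m
    rw [huUR]
    exact nextF_spec (iot U) (iot W) (F m) hUWR
  have hFm : ∀ m ≤ n, F m = PowerSeries.X ^ (n - m) * (V ^ n * J ^ k) * iot W ^ m :=
    fun m hm => seqF_eq (iot W) (V ^ n * J ^ k) n m hm
  have hT0 : TT (iot X) (iot Y) n k 0 (F 0) = 0 := by
    rw [hF, seqF, ← mul_assoc]; exact hT
  have hexp : ∀ m, TT (iot X) (iot Y) n k m (F m) =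
      iot X * (PowerSeries.C (4 * (Polynomial.derivative (φ m) + (n : Polynomial ℂ) * φ m
        - (m : Polynomial ℂ) * φ m)) + iot u * PowerSeries.C (rho n k m (φ m)))
      + iot u * TT (iot X) (iot Y) n k (m + 1) (F (m + 1)) := by
    intro m
    conv_lhs => rw [hstep m]
    rw [TT_add, TT_C _ _ _ huR, TT_u _ _ _ duR (dt_iot _)]
  -- extraction step
  have hext : ∀ (m : ℕ) (r : Polynomial ℂ),
      TT (iot X) (iot Y) n k m (F m) + iot X * PowerSeries.C r = 0 →
      (4 * (Polynomial.derivative (φ m) + (n : Polynomial ℂ) * φ m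
        - (m : Polynomial ℂ) * φ m) + r = 0) ∧
      TT (iot X) (iot Y) n k (m + 1) (F (m + 1)) + iot X * PowerSeries.C (rho n k m (φ m)) = 0 := by
    intro m r h
    rw [hexp] at h
    have h1 : 4 * (Polynomial.derivative (φ m) + (n : Polynomial ℂ) * φ m
        - (m : Polynomial ℂ) * φ m) + r = 0 := by
      have := congrArg PowerSeries.constantCoeff h
      simp only [map_add PowerSeries.constantCoeff, map_mul PowerSeries.constantCoeff, hX0R, hu0,
        PowerSeries.constantCoeff_C, map_zero] at this
      linear_combination this
    refine ⟨h1, ?_⟩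
    apply mul_left_cancel₀ huneR
    have h2 := congrArg (PowerSeries.C : Polynomial ℂ →+* RR) h1
    rw [map_add, map_zero] at h2
    linear_combination h - iot X * h2
  have hall : ∀ m : ℕ, TT (iot X) (iot Y) n k (m + 1) (F (m + 1)) +
      iot X * PowerSeries.C (rho n k m (φ m)) = 0 := by
    intro m
    induction m with
    | zero => exact (hext 0 0 (by rw [hT0]; simp)).2
    | succ m ih => exact (hext (m + 1) _ ih).2
  refine ⟨φ, fun m => ez (F m), ?_, ?_, ?_, ?_, ?_, ?_⟩
  · have h := (hext 0 0 (by rw [hT0]; simp)).1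
    have h4 : (4 : Polynomial ℂ) ≠ 0 := by norm_num
    apply mul_left_cancel₀ h4
    rw [Nat.cast_zero] at h
    linear_combination h
  · intro m
    exact (hext (m + 1) _ (hall m)).1
  · intro m hm
    rw [hφ]
    simp only
    rw [hFm m hm.le, map_mul, map_mul, map_pow, PowerSeries.constantCoeff_X,
      zero_pow (by omega), zero_mul, zero_mul]
  · rw [hφ]
    simp only
    rw [hFm n le_rfl, Nat.sub_self]
    simp only [map_mul PowerSeries.constantCoeff, map_pow PowerSeries.constantCoeff, hV0, hJ0,
      constantCoeff_iot, hW0]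
    simp
  · show X ^ k * ez (F 0) = _
    rw [hFm 0 (Nat.zero_le _)]
    simp only [map_mul ez, map_pow ez, ezV, ez_X]
    have : X ^ k * ez J ^ k = 1 := by rw [← mul_pow, ezJ, one_pow]
    simp only [Nat.sub_zero, pow_zero, one_pow, one_mul, mul_one]
    linear_combination (PowerSeries.X ^ n) * this
  · intro m
    show ez (F m) = _
    conv_lhs => rw [hstep m]
    rw [map_add, map_mul, ez_C, ez_iot]

lemma aeval_homog (k : ℕ) (P : MvPolynomial (Fin 2) ℂ) (hP : P.IsHomogeneous k)
    (z u : PowerSeries ℂ) :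
    MvPolynomial.aeval ![z, z * u] P = z ^ k *
      Polynomial.aeval u (MvPolynomial.aeval ![1, Polynomial.X] P : Polynomial ℂ) := by
  rw [MvPolynomial.aeval_def, MvPolynomial.aeval_def, MvPolynomial.eval₂_eq', MvPolynomial.eval₂_eq',
    map_sum, Finset.mul_sum]
  refine Finset.sum_congr rfl fun d hd => ?_
  have hdeg : d 0 + d 1 = k := by
    have := hP (MvPolynomial.mem_support_iff.1 hd)
    rw [Finsupp.weight_apply, Finsupp.sum_fintype _ _ (by simp)] at this
    simpa [Fin.sum_univ_two] using this
  rw [Fin.prod_univ_two, Fin.prod_univ_two, ← hdeg]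
  simp only [Matrix.cons_val_zero, Matrix.cons_val_one, map_mul, map_pow, map_one, one_pow,
    Polynomial.aeval_X, one_mul]
  rw [show (algebraMap ℂ (Polynomial ℂ)) = Polynomial.C from rfl, Polynomial.aeval_C]
  ring

lemma init_vals (k : ℕ) (P : MvPolynomial (Fin 2) ℂ) (hP : P.IsHomogeneous k) (c : ℕ → ℂ)
    (X Y u U : PowerSeries ℂ)
    (hX0 : PowerSeries.constantCoeff X = 1)
    (hu : X * u = -Y) (huU : u = PowerSeries.X * U)
    (hU0 : PowerSeries.constantCoeff U = -16)
    (hc : PowerSeries.mk c = MvPolynomial.aeval ![-X, Y] P)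
    (φ : ℕ → ℕ → Polynomial ℂ) (G : ℕ → ℕ → PowerSeries ℂ)
    (hG0 : ∀ n, X ^ k * G n 0 = PowerSeries.X ^ n)
    (hG : ∀ n m, G n m = PowerSeries.C ((φ n m).eval 0) + u * G n (m + 1)) (N : ℕ) :
    ∀ m ≤ N, ∑ n ∈ Finset.range (N + 1), (-1) ^ k * c n * (φ n m).eval 0 =
      (MvPolynomial.aeval ![1, Polynomial.X] P : Polynomial ℂ).coeff m := by
  set p : Polynomial ℂ := MvPolynomial.aeval ![1, Polynomial.X] P with hp
  have hcp : PowerSeries.mk c = (-X) ^ k * Polynomial.aeval u p := by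
    rw [hc, hp, ← aeval_homog k P hP]
    congr 2
    rw [neg_mul, hu, neg_neg]
  have hXne : X ≠ 0 := by rintro rfl; simp at hX0
  have hUne : PowerSeries.constantCoeff U ≠ 0 := by rw [hU0]; norm_num
  obtain ⟨W, hUW⟩ : ∃ W, U * W = 1 := ⟨U⁻¹, PowerSeries.mul_inv_cancel _ hUne⟩
  obtain ⟨Z, hXZ⟩ : ∃ Z, X * Z = 1 :=
    ⟨X⁻¹, PowerSeries.mul_inv_cancel _ (by rw [hX0]; exact one_ne_zero)⟩
  set pm : ℕ → Polynomial ℂ := fun m => Polynomial.divX^[m] p with hpm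
  set H : ℕ → PowerSeries ℂ := fun m =>
    ∑ n ∈ Finset.range (N + 1), PowerSeries.C ((-1) ^ k * c n) * G n m - Polynomial.aeval u (pm m)
    with hH
  set d : ℕ → ℂ := fun m => ∑ n ∈ Finset.range (N + 1), (-1) ^ k * c n * (φ n m).eval 0 - (pm m).coeff 0
    with hd
  have hpmc : ∀ m j, (pm m).coeff j = p.coeff (j + m) := by
    intro m
    induction m with
    | zero => intro j; rfl
    | succ m ih =>
      intro j
      rw [hpm]
      simp only
      rw [Function.iterate_succ_apply', Polynomial.coeff_divX]
      rw [hpm] at ih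
      simp only at ih
      rw [ih]
      congr 1; omega
  have hHs : ∀ m, H m = PowerSeries.C (d m) + u * H (m + 1) := by
    intro m
    have e1 : Polynomial.aeval u (pm m) = PowerSeries.C ((pm m).coeff 0) +
        u * Polynomial.aeval u (pm (m + 1)) := by
      have : pm (m + 1) = (pm m).divX := Function.iterate_succ_apply' _ _ _
      rw [this]
      conv_lhs => rw [← Polynomial.divX_mul_X_add (pm m)]
      rw [map_add, map_mul, Polynomial.aeval_X, Polynomial.aeval_C]
      rw [show (algebraMap ℂ (PowerSeries ℂ)) = PowerSeries.C from rfl]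
      ring
    have e2 : ∑ n ∈ Finset.range (N + 1), PowerSeries.C ((-1) ^ k * c n) * G n m =
        PowerSeries.C (∑ n ∈ Finset.range (N + 1), (-1) ^ k * c n * (φ n m).eval 0) +
        u * ∑ n ∈ Finset.range (N + 1), PowerSeries.C ((-1) ^ k * c n) * G n (m + 1) := by
      rw [map_sum, Finset.mul_sum, ← Finset.sum_add_distrib]
      refine Finset.sum_congr rfl fun n _ => ?_
      rw [hG n m, map_mul PowerSeries.C ((-1) ^ k * c n)]
      ring
    rw [hH, hd]
    simp only
    rw [e1, e2, map_sub]
    ring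
  have hH0 : PowerSeries.X ^ (N + 1) ∣ H 0 := by
    have e : H 0 = Z ^ k * (X ^ k * H 0) := by
      rw [← mul_assoc, ← mul_pow, mul_comm Z, hXZ, one_pow, one_mul]
    have e2 : X ^ k * H 0 = PowerSeries.C ((-1) ^ k) *
        (∑ n ∈ Finset.range (N + 1), PowerSeries.C (c n) * PowerSeries.X ^ n - PowerSeries.mk c) := by
      rw [hcp, hH]
      simp only
      rw [mul_sub, Finset.mul_sum, mul_sub, Finset.mul_sum]
      congr 1
      · refine Finset.sum_congr rfl fun n _ => ?_
        rw [← hG0 n, map_mul]; ring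
      · rw [neg_pow X k, map_pow, map_neg, map_one]
        have : ((-1 : PowerSeries ℂ)) ^ k * (-1) ^ k = 1 := by
          rw [← mul_pow]; simp
        show X ^ k * Polynomial.aeval u p = _
        linear_combination (-(X ^ k) * Polynomial.aeval u p) * this
    rw [e, e2]
    refine Dvd.dvd.mul_left (Dvd.dvd.mul_left ?_ _) _
    rw [PowerSeries.X_pow_dvd_iff]
    intro m hm
    rw [map_sub, map_sum, PowerSeries.coeff_mk]
    simp only [PowerSeries.coeff_C_mul, PowerSeries.coeff_X_pow]
    rw [Finset.sum_eq_single m]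
    · simp
    · intro b _ hb
      rw [if_neg (Ne.symm hb), mul_zero]
    · intro hm'
      exact absurd (Finset.mem_range.2 hm) hm'
  have hd0 : ∀ m, m ≤ N → PowerSeries.X ∣ H m → d m = 0 := by
    intro m _ h
    have := PowerSeries.X_dvd_iff.1 h
    rw [hHs m, huU] at this
    simpa using this
  have hHm : ∀ m, m ≤ N → PowerSeries.X ^ (N + 1 - m) ∣ H m := by
    intro m
    induction m with
    | zero => intro _; exact hH0
    | succ m ih =>
      intro hm
      have h := ih (by omega)
      have hz := hd0 m (by omega) ((dvd_pow_self _ (by omega)).trans h)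
      rw [hHs m, hz, map_zero, zero_add, huU, show N + 1 - m = (N + 1 - (m + 1)) + 1 by omega,
        pow_succ'] at h
      obtain ⟨r, hr⟩ := h
      have : U * H (m + 1) = PowerSeries.X ^ (N + 1 - (m + 1)) * r := by
        apply mul_left_cancel₀ (PowerSeries.X_ne_zero (R := ℂ))
        linear_combination hr
      exact ⟨W * r, by linear_combination W * this - H (m + 1) * hUW⟩
  intro m hm
  have := hd0 m hm ((dvd_pow_self _ (by omega)).trans (hHm m hm))
  rw [hd] at this
  simp only at this
  rw [hpmc, zero_add] at this
  exact sub_eq_zero.1 this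

/-- Coercion of polynomials into rational functions. -/
abbrev rf : Polynomial ℂ →+* RatFunc ℂ := algebraMap (Polynomial ℂ) (RatFunc ℂ)

lemma rf_ne {q : Polynomial ℂ} (hq : q ≠ 0) : rf q ≠ 0 := RatFunc.algebraMap_ne_zero hq

lemma rd_div_aux (f : RatFunc ℂ) (n d p q : Polynomial ℂ) (hd : d ≠ 0) (hq : q ≠ 0)
    (hnd : rf n / rf d = f) (hf : f = rf p / rf q) :
    rf (Polynomial.derivative n * d - n * Polynomial.derivative d) / rf (d ^ 2) =
      rf (Polynomial.derivative p * q - p * Polynomial.derivative q) / rf (q ^ 2) := by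
  have h1 : n * q = p * d := by
    have h := hnd.trans hf
    rw [div_eq_div_iff (rf_ne hd) (rf_ne hq), ← map_mul, ← map_mul] at h
    exact RatFunc.algebraMap_injective ℂ h
  have h2 := congrArg Polynomial.derivative h1
  rw [Polynomial.derivative_mul, Polynomial.derivative_mul] at h2
  rw [div_eq_div_iff (rf_ne (pow_ne_zero 2 hd)) (rf_ne (pow_ne_zero 2 hq)),
    ← map_mul, ← map_mul]
  refine congrArg rf ?_
  generalize Polynomial.derivative n = n' at *
  generalize Polynomial.derivative d = d' at *
  generalize Polynomial.derivative p = p' at *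
  generalize Polynomial.derivative q = q' at *
  linear_combination (d * q) * h2 - (d' * q + d * q') * h1

lemma rd_div (p q : Polynomial ℂ) (hq : q ≠ 0) :
    ratDeriv (rf p / rf q) =
      rf (Polynomial.derivative p * q - p * Polynomial.derivative q) / rf (q ^ 2) := by
  rw [ratDeriv, RatFunc.mk_eq_div]
  exact rd_div_aux _ _ _ p q (RatFunc.denom_ne_zero _) hq (RatFunc.num_div_denom _) rfl

lemma exists_rep (f : RatFunc ℂ) : ∃ p q : Polynomial ℂ, q ≠ 0 ∧ f = rf p / rf q :=
  ⟨f.num, f.denom, RatFunc.denom_ne_zero f, (RatFunc.num_div_denom f).symm⟩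

lemma rd_add (f g : RatFunc ℂ) : ratDeriv (f + g) = ratDeriv f + ratDeriv g := by
  obtain ⟨p, q, hq, rfl⟩ := exists_rep f
  obtain ⟨r, s, hs, rfl⟩ := exists_rep g
  have e : rf p / rf q + rf r / rf s = rf (p * s + r * q) / rf (q * s) := by
    rw [map_add, map_mul, map_mul, map_mul]
    field_simp [rf_ne hq, rf_ne hs]
  rw [e, rd_div _ _ (mul_ne_zero hq hs), rd_div _ _ hq, rd_div _ _ hs]
  have h1 := rf_ne hq
  have h2 := rf_ne hs
  simp only [Polynomial.derivative_add, Polynomial.derivative_mul, map_add, map_mul, map_sub, map_pow]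
  field_simp
  ring

lemma rd_mul (f g : RatFunc ℂ) : ratDeriv (f * g) = f * ratDeriv g + g * ratDeriv f := by
  obtain ⟨p, q, hq, rfl⟩ := exists_rep f
  obtain ⟨r, s, hs, rfl⟩ := exists_rep g
  have e : rf p / rf q * (rf r / rf s) = rf (p * r) / rf (q * s) := by
    rw [map_mul, map_mul, div_mul_div_comm]
  rw [e, rd_div _ _ (mul_ne_zero hq hs), rd_div _ _ hq, rd_div _ _ hs]
  have h1 := rf_ne hq
  have h2 := rf_ne hs
  simp only [Polynomial.derivative_mul, map_add, map_mul, map_sub, map_pow]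
  field_simp
  ring

lemma rd_C (z : ℂ) : ratDeriv (RatFunc.C z) = 0 := by
  have : RatFunc.C z = rf (Polynomial.C z) / rf 1 := by simp
  rw [this, rd_div _ _ one_ne_zero]
  simp

lemma rd_X : ratDeriv RatFunc.X = 1 := by
  have : (RatFunc.X : RatFunc ℂ) = rf Polynomial.X / rf 1 := by simp
  rw [this, rd_div _ _ one_ne_zero]
  simp

lemma rd_zero : ratDeriv 0 = 0 := by
  have := rd_C 0
  rwa [map_zero] at this

lemma rd_Cmul (z : ℂ) (f : RatFunc ℂ) : ratDeriv (RatFunc.C z * f) = RatFunc.C z * ratDeriv f := by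
  rw [rd_mul, rd_C]; ring

lemma one_sub_ne (n : ℕ) : (1 - (n : RatFunc ℂ) * RatFunc.X) ≠ 0 := by
  have : (1 - (n : RatFunc ℂ) * RatFunc.X) = rf (1 - (n : Polynomial ℂ) * Polynomial.X) := by simp
  rw [this]
  apply rf_ne
  intro h
  have := congrArg (Polynomial.eval 0) h
  simp at this

/-- `1/(1 - n v)`. -/
def ss (n : ℕ) : RatFunc ℂ := (1 - (n : RatFunc ℂ) * RatFunc.X)⁻¹

lemma ss_mul (n : ℕ) : (1 - (n : RatFunc ℂ) * RatFunc.X) * ss n = 1 := mul_inv_cancel₀ (one_sub_ne n)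

lemma rd_natCast (n : ℕ) : ratDeriv (n : RatFunc ℂ) = 0 := by
  rw [← map_natCast (RatFunc.C : ℂ →+* RatFunc ℂ), rd_C]

lemma rd_one : ratDeriv (1 : RatFunc ℂ) = 0 := by
  simpa using rd_natCast 1

lemma rd_ss (n : ℕ) : ratDeriv (ss n) = n * ss n ^ 2 := by
  have h := ss_mul n
  have h2 := congrArg ratDeriv h
  have e : (1 - (n : RatFunc ℂ) * RatFunc.X) = 1 + RatFunc.C (-(n : ℂ)) * RatFunc.X := by
    rw [map_neg, map_natCast]; ring
  rw [rd_mul, rd_one, e, rd_add, rd_one, rd_Cmul, rd_X, ← e, map_neg, map_natCast] at h2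
  linear_combination (ss n) * h2 - ratDeriv (ss n) * h

lemma rd_pow (f : RatFunc ℂ) (j : ℕ) :
    ratDeriv (f ^ (j + 1)) = ((j : RatFunc ℂ) + 1) * f ^ j * ratDeriv f := by
  induction j with
  | zero => simp
  | succ j ih =>
    rw [pow_succ, rd_mul, ih]
    push_cast
    ring

/-- Laplace image of `t^j e^{nt}`. -/
def bb (n j : ℕ) : RatFunc ℂ := (j.factorial : RatFunc ℂ) * (RatFunc.X * ss n) ^ j * ss n

/-- The Laplace transform of `φ(t)e^{nt}`. -/
def Lap (n : ℕ) (φ : Polynomial ℂ) : RatFunc ℂ := φ.sum fun j z => RatFunc.C z * bb n j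

lemma Lap_add (n : ℕ) (φ ψ : Polynomial ℂ) : Lap n (φ + ψ) = Lap n φ + Lap n ψ := by
  rw [Lap, Polynomial.sum_add_index]
  · rfl
  · intro i; simp
  · intro i a b; rw [map_add]; ring

lemma Lap_monomial (n j : ℕ) (z : ℂ) : Lap n (Polynomial.monomial j z) = RatFunc.C z * bb n j := by
  rw [Lap, Polynomial.sum_monomial_index]
  simp

lemma Lap_zero (n : ℕ) : Lap n 0 = 0 := by
  simp [Lap]

lemma Lap_Cmul (n : ℕ) (z : ℂ) (φ : Polynomial ℂ) :
    Lap n (Polynomial.C z * φ) = RatFunc.C z * Lap n φ := by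
  induction φ using Polynomial.induction_on' with
  | add p q hp hq => rw [mul_add, Lap_add, hp, hq, Lap_add]; ring
  | monomial j a => rw [Polynomial.C_mul_monomial, Lap_monomial, Lap_monomial, map_mul]; ring

lemma Lap_X (n : ℕ) (φ : Polynomial ℂ) :
    Lap n (Polynomial.X * φ) = RatFunc.X * ratDeriv (RatFunc.X * Lap n φ) := by
  induction φ using Polynomial.induction_on' with
  | add p q hp hq => rw [mul_add, Lap_add, hp, hq, Lap_add, mul_add, rd_add]; ring
  | monomial j a =>
    rw [Polynomial.X_mul_monomial, Lap_monomial, Lap_monomial]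
    have e : RatFunc.X * (RatFunc.C a * bb n j) =
        RatFunc.C (a * (j.factorial : ℂ)) * (RatFunc.X * ss n) ^ (j + 1) := by
      rw [bb, map_mul, map_natCast]; ring
    rw [e, rd_Cmul, rd_pow, rd_mul, rd_X, rd_ss, bb, Nat.factorial_succ, map_mul, map_natCast]
    push_cast
    have h := ss_mul n
    linear_combination (RatFunc.C a * (j.factorial : RatFunc ℂ) * (j + 1) * RatFunc.X
      * (RatFunc.X * ss n) ^ j * ss n) * h

lemma Lap_D (n : ℕ) (φ : Polynomial ℂ) :
    RatFunc.X * Lap n (Polynomial.derivative φ + (n : Polynomial ℂ) * φ) =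
      Lap n φ - RatFunc.C (φ.eval 0) := by
  induction φ using Polynomial.induction_on' with
  | add p q hp hq =>
    rw [Polynomial.derivative_add, show Polynomial.derivative p + Polynomial.derivative q +
      (n : Polynomial ℂ) * (p + q) = (Polynomial.derivative p + (n : Polynomial ℂ) * p) +
      (Polynomial.derivative q + (n : Polynomial ℂ) * q) by ring, Lap_add, mul_add, hp, hq, Lap_add,
      Polynomial.eval_add, map_add]
    ring
  | monomial j a =>
    have hn : (n : Polynomial ℂ) = Polynomial.C (n : ℂ) := by simp
    rw [Lap_add, hn, Lap_Cmul, Polynomial.derivative_monomial, Lap_monomial, Lap_monomial, map_natCast]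
    have h := ss_mul n
    cases j with
    | zero =>
      simp only [Nat.cast_zero, mul_zero, map_zero, zero_mul, zero_add, bb, Nat.factorial_zero,
        Nat.cast_one, pow_zero, one_mul, mul_one]
      rw [show Polynomial.eval 0 (Polynomial.monomial 0 a) = a by simp]
      linear_combination (-RatFunc.C a) * h
    | succ j =>
      rw [show Polynomial.eval 0 (Polynomial.monomial (j + 1) a) = 0 by simp, map_zero, map_mul,
        map_natCast, bb, bb, Nat.factorial_succ]
      simp only [Nat.add_sub_cancel]
      push_cast
      linear_combination (-RatFunc.C a * ((j : RatFunc ℂ) + 1) * (j.factorial : RatFunc ℂ) *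
        (RatFunc.X * ss n) ^ j * RatFunc.X * ss n) * h

/-- The left side of the recurrence at index `m+1`. -/
def QQ (k m : ℕ) (hp h : RatFunc ℂ) : RatFunc ℂ :=
  h / RatFunc.X - RatFunc.C ((m : ℂ) + 1) * h + RatFunc.C ((m : ℂ) - k) * hp
    - RatFunc.X * ratDeriv hp
    + RatFunc.C ((2 * (k : ℂ) - 1) / 4) * (RatFunc.X * ratDeriv (RatFunc.X * hp))
    + RatFunc.C (1 / 4 : ℂ) * (RatFunc.X * ratDeriv (RatFunc.X * ratDeriv (RatFunc.X * hp)))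

lemma QQ_add (k m : ℕ) (a b c d : RatFunc ℂ) :
    QQ k m (a + b) (c + d) = QQ k m a c + QQ k m b d := by
  simp only [QQ, mul_add, rd_add, add_div]
  ring

lemma QQ_Cmul (k m : ℕ) (z : ℂ) (a c : RatFunc ℂ) :
    QQ k m (RatFunc.C z * a) (RatFunc.C z * c) = RatFunc.C z * QQ k m a c := by
  have e : ∀ f : RatFunc ℂ, RatFunc.X * (RatFunc.C z * f) = RatFunc.C z * (RatFunc.X * f) := by
    intro f; ring
  simp only [QQ, e, rd_Cmul]
  ring

lemma QQ_zero (k m : ℕ) : QQ k m 0 0 = 0 := by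
  simp [QQ, rd_zero]

lemma QQ_sum (k m : ℕ) (s : Finset ℕ) (z : ℕ → ℂ) (a c : ℕ → RatFunc ℂ) :
    QQ k m (∑ n ∈ s, RatFunc.C (z n) * a n) (∑ n ∈ s, RatFunc.C (z n) * c n) =
      ∑ n ∈ s, RatFunc.C (z n) * QQ k m (a n) (c n) := by
  classical
  induction s using Finset.induction_on with
  | empty => simp [QQ_zero]
  | insert i s hi ih =>
    rw [Finset.sum_insert hi, Finset.sum_insert hi, Finset.sum_insert hi, QQ_add, ih, QQ_Cmul]

lemma Lap_rec (n k m : ℕ) (φ ψ : Polynomial ℂ)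
    (h : 4 * (Polynomial.derivative ψ + (n : Polynomial ℂ) * ψ
        - ((m + 1 : ℕ) : Polynomial ℂ) * ψ) + rho n k m φ = 0) :
    QQ k m (Lap n φ) (Lap n ψ) = RatFunc.C (ψ.eval 0) / RatFunc.X := by
  have hX : (RatFunc.X : RatFunc ℂ) ≠ 0 := RatFunc.X_ne_zero
  have hφ := Lap_D n φ
  have hψ := Lap_D n ψ
  set dφ := Polynomial.derivative φ + (n : Polynomial ℂ) * φ with hdφ
  set dψ := Polynomial.derivative ψ + (n : Polynomial ℂ) * ψ with hdψ
  have h1 : Lap n (Polynomial.X * dφ) = RatFunc.X * ratDeriv (Lap n φ) := by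
    rw [Lap_X, hφ, sub_eq_add_neg, rd_add, ← map_neg, rd_C, add_zero]
  have h2 : Lap n (Polynomial.X * (Polynomial.X * dφ)) =
      RatFunc.X * ratDeriv (RatFunc.X * (RatFunc.X * ratDeriv (Lap n φ))) := by
    rw [Lap_X, h1]
  have h3 := Lap_X n φ
  have hL : (Polynomial.C 4 * dψ + Polynomial.C (-4 * ((m : ℂ) + 1)) * ψ)
      + (Polynomial.X * (Polynomial.X * dφ) + Polynomial.C (-4) * (Polynomial.X * dφ)
      + Polynomial.C (4 * (m : ℂ) - 4 * (k : ℂ)) * φ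
      + Polynomial.C (2 * (k : ℂ)) * (Polynomial.X * φ)) = 0 := by
    rw [← h, rho]
    push_cast
    simp only [map_mul, map_add, map_sub, map_neg, map_natCast, map_one, map_ofNat]
    ring
  have := congrArg (Lap n) hL
  simp only [Lap_add, Lap_Cmul, Lap_zero, h1, h2, h3] at this
  have e4 : ratDeriv (RatFunc.X * ratDeriv (RatFunc.X * Lap n φ)) =
      ratDeriv (RatFunc.X * Lap n φ) + ratDeriv (RatFunc.X * (RatFunc.X * ratDeriv (Lap n φ))) := by
    rw [← rd_add]
    congr 1
    rw [rd_mul RatFunc.X (Lap n φ), rd_X]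
    ring
  have hψ' : Lap n dψ = (Lap n ψ - RatFunc.C (ψ.eval 0)) / RatFunc.X := by
    rw [eq_div_iff hX, mul_comm, hψ]
  rw [hψ', sub_div] at this
  rw [QQ, e4]
  have n4 : (RatFunc.C (4 : ℂ) : RatFunc ℂ) = 4 := map_ofNat RatFunc.C 4
  have n2 : (RatFunc.C (2 : ℂ) : RatFunc ℂ) = 2 := map_ofNat RatFunc.C 2
  simp only [map_div₀, map_mul, map_add, map_sub, map_neg, map_natCast, map_one, n4, n2] at this ⊢
  linear_combination (1 / 4 : RatFunc ℂ) * this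

lemma Lap_rec_zero (n : ℕ) (φ : Polynomial ℂ)
    (h : Polynomial.derivative φ + (n : Polynomial ℂ) * φ = 0) :
    Lap n φ = RatFunc.C (φ.eval 0) := by
  have := Lap_D n φ
  rw [h, Lap_zero, mul_zero] at this
  exact (sub_eq_zero.1 this.symm)

lemma QQ_unique (k m : ℕ) (hp h h' : RatFunc ℂ) (e : QQ k m hp h = QQ k m hp h') : h = h' := by
  have hX : (RatFunc.X : RatFunc ℂ) ≠ 0 := RatFunc.X_ne_zero
  rw [QQ, QQ] at e
  have e1 : (h - h') / RatFunc.X - RatFunc.C ((m : ℂ) + 1) * (h - h') = 0 := by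
    rw [sub_div]
    linear_combination e
  have e2 : (1 - ((m + 1 : ℕ) : RatFunc ℂ) * RatFunc.X) * (h - h') = 0 := by
    have : (h - h') = (h - h') / RatFunc.X * RatFunc.X := by field_simp
    rw [map_add, map_natCast, map_one] at e1
    push_cast
    linear_combination this + RatFunc.X * e1
  rcases mul_eq_zero.1 e2 with h0 | h0
  · exact absurd h0 (one_sub_ne (m + 1))
  · exact sub_eq_zero.1 h0

/-- Regularity of a rational function at a point. -/
def Reg (z : ℂ) (f : RatFunc ℂ) : Prop :=
  ∃ p q : Polynomial ℂ, q.eval z ≠ 0 ∧ f = rf p / rf q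

lemma ne_of_eval {q : Polynomial ℂ} {z : ℂ} (h : q.eval z ≠ 0) : q ≠ 0 := by
  rintro rfl; simp at h

lemma Reg.add {z : ℂ} {f g : RatFunc ℂ} (hf : Reg z f) (hg : Reg z g) : Reg z (f + g) := by
  obtain ⟨p, q, hq, rfl⟩ := hf
  obtain ⟨r, s, hs, rfl⟩ := hg
  refine ⟨p * s + q * r, q * s, by rw [Polynomial.eval_mul]; exact mul_ne_zero hq hs, ?_⟩
  rw [div_add_div _ _ (rf_ne (ne_of_eval hq)) (rf_ne (ne_of_eval hs))]
  simp only [map_add, map_mul]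

lemma Reg.mul {z : ℂ} {f g : RatFunc ℂ} (hf : Reg z f) (hg : Reg z g) : Reg z (f * g) := by
  obtain ⟨p, q, hq, rfl⟩ := hf
  obtain ⟨r, s, hs, rfl⟩ := hg
  refine ⟨p * r, q * s, by rw [Polynomial.eval_mul]; exact mul_ne_zero hq hs, ?_⟩
  rw [div_mul_div_comm, map_mul, map_mul]

lemma Reg.poly (z : ℂ) (p : Polynomial ℂ) : Reg z (rf p) := ⟨p, 1, by simp, by simp⟩

lemma Reg.C (z a : ℂ) : Reg z (RatFunc.C a) := by
  simpa using Reg.poly z (Polynomial.C a)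

lemma Reg.X (z : ℂ) : Reg z RatFunc.X := by
  simpa using Reg.poly z Polynomial.X

lemma Reg.zero (z : ℂ) : Reg z 0 := by
  simpa using Reg.poly z 0

lemma Reg.pow {z : ℂ} {f : RatFunc ℂ} (hf : Reg z f) (n : ℕ) : Reg z (f ^ n) := by
  induction n with
  | zero => simpa using Reg.poly z 1
  | succ n ih => rw [pow_succ]; exact ih.mul hf

lemma Reg.sum {z : ℂ} (s : Finset ℕ) (f : ℕ → RatFunc ℂ) (h : ∀ i ∈ s, Reg z (f i)) :
    Reg z (∑ i ∈ s, f i) := by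
  classical
  induction s using Finset.induction_on with
  | empty => simpa using Reg.zero z
  | insert i s hi ih =>
    rw [Finset.sum_insert hi]
    exact (h i (Finset.mem_insert_self _ _)).add (ih fun j hj => h j (Finset.mem_insert_of_mem hj))

lemma reg_Lap {z : ℂ} (n : ℕ) (hz : 1 - (n : ℂ) * z ≠ 0) (φ : Polynomial ℂ) : Reg z (Lap n φ) := by
  have hs : Reg z (ss n) :=
    ⟨1, 1 - (n : Polynomial ℂ) * Polynomial.X, by simpa using hz, by simp [ss]⟩
  have hb : ∀ j, Reg z (bb n j) := by
    intro j
    have hj : Reg z (j.factorial : RatFunc ℂ) := by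
      simpa using Reg.C z (j.factorial : ℂ)
    exact (hj.mul (((Reg.X z).mul hs).pow j)).mul hs
  induction φ using Polynomial.induction_on' with
  | add p q hp hq => rw [Lap_add]; exact hp.add hq
  | monomial j a => rw [Lap_monomial]; exact (Reg.C z a).mul (hb j)

lemma eval_rf_div (p q : Polynomial ℂ) (z : ℂ) (hq : q.eval z ≠ 0) :
    RatFunc.eval (RingHom.id ℂ) z (rf p / rf q) = p.eval z / q.eval z := by
  have hd : (rf p / rf q).denom ∣ q := RatFunc.denom_div_dvd p q
  have hdz : (rf p / rf q).denom.eval z ≠ 0 := by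
    obtain ⟨r, hr⟩ := hd
    intro h
    apply hq
    rw [hr, Polynomial.eval_mul, h, zero_mul]
  have h := RatFunc.num_div_denom (rf p / rf q)
  have h1 : (rf p / rf q).num * q = p * (rf p / rf q).denom := by
    rw [div_eq_div_iff (rf_ne (RatFunc.denom_ne_zero _)) (rf_ne (ne_of_eval hq)),
      ← map_mul, ← map_mul] at h
    exact RatFunc.algebraMap_injective ℂ h
  have h2 := congrArg (Polynomial.eval z) h1
  rw [Polynomial.eval_mul, Polynomial.eval_mul] at h2
  rw [RatFunc.eval, Polynomial.eval₂_id, Polynomial.eval₂_id, div_eq_div_iff hdz hq, h2]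

lemma residue_limit (m : ℕ) (hm : 1 ≤ m) (A : ℂ) (r : RatFunc ℂ) (hr : Reg ((1 : ℂ) / m) r) :
    Tendsto (fun v : ℂ => (v - 1 / m) * RatFunc.eval (RingHom.id ℂ) v (RatFunc.C A * ss m + r))
      (𝓝[≠] ((1 : ℂ) / m)) (𝓝 (-(A / m))) := by
  obtain ⟨p, q, hq, rfl⟩ := hr
  have hm0 : (m : ℂ) ≠ 0 := by exact_mod_cast (by omega : m ≠ 0)
  set l : Polynomial ℂ := 1 - (m : Polynomial ℂ) * Polynomial.X with hl
  have hlr : rf l = 1 - (m : RatFunc ℂ) * RatFunc.X := by simp [hl]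
  have hf : RatFunc.C A * ss m + rf p / rf q = rf (Polynomial.C A * q + l * p) / rf (l * q) := by
    rw [ss, ← hlr]
    have h1 : rf l ≠ 0 := by rw [hlr]; exact one_sub_ne m
    have h2 := rf_ne (ne_of_eval hq)
    rw [map_add, map_mul, map_mul, map_mul, RatFunc.algebraMap_C]
    field_simp
  rw [hf]
  have hlim : Tendsto (fun v : ℂ => -((1 : ℂ) / m) * ((A * q.eval v + (1 - m * v) * p.eval v) / q.eval v))
      (𝓝[≠] ((1 : ℂ) / m)) (𝓝 (-(A / m))) := by
    have hc : ContinuousAt (fun v : ℂ => -((1 : ℂ) / m) *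
        ((A * q.eval v + (1 - m * v) * p.eval v) / q.eval v)) ((1 : ℂ) / m) := by
      refine continuousAt_const.mul (ContinuousAt.div ?_ q.continuous.continuousAt hq)
      have : Continuous fun v : ℂ => A * q.eval v + (1 - m * v) * p.eval v := by
        have := q.continuous
        have := p.continuous
        fun_prop
      exact this.continuousAt
    have h := hc.tendsto.mono_left (nhdsWithin_le_nhds (s := {((1 : ℂ) / m)}ᶜ))
    convert h using 2
    field_simp
    ring
  refine hlim.congr' ?_
  have h1 : ∀ᶠ v in 𝓝[≠] ((1 : ℂ) / m), q.eval v ≠ 0 :=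
    nhdsWithin_le_nhds (q.continuous.continuousAt.eventually_ne hq)
  filter_upwards [h1, self_mem_nhdsWithin] with v hv1 hv2
  have hle : l.eval v = 1 - m * v := by simp [hl]
  have hl0 : (1 - m * v : ℂ) ≠ 0 := by
    intro h
    apply hv2
    rw [Set.mem_singleton_iff, eq_div_iff hm0]
    linear_combination -h
  rw [eval_rf_div _ _ _ (by rw [Polynomial.eval_mul, hle]; exact mul_ne_zero hl0 hv1)]
  simp only [Polynomial.eval_add, Polynomial.eval_mul, Polynomial.eval_C, hle]
  have : v - 1 / m = -(1 / m) * (1 - m * v) := by field_simp; ring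
  rw [this]
  field_simp

theorem residue_core
    (k : ℕ)
    (P : MvPolynomial (Fin 2) ℂ) (hP : P.IsHomogeneous k)
    (c : ℕ → ℂ)
    (hcsum : ∀ τ : ℂ, 0 < τ.im →
      Summable (fun n : ℕ => ‖c n * Complex.exp (Real.pi * Complex.I * n * τ)‖))
    (hc : ∀ τ : ℂ, 0 < τ.im →
      MvPolynomial.eval ![xx τ, yy τ] P
        = ∑' n : ℕ, c n * Complex.exp (Real.pi * Complex.I * n * τ))
    (h : ℕ → RatFunc ℂ)
    (h0 : h 0 = RatFunc.C ((MvPolynomial.aeval ![1, Polynomial.X] P : Polynomial ℂ).coeff 0))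
    (hrec : ∀ m : ℕ, QQ k m (h m) (h (m + 1)) =
      RatFunc.C ((MvPolynomial.aeval ![1, Polynomial.X] P : Polynomial ℂ).coeff (m + 1)) / RatFunc.X)
    (m : ℕ) (hm : 1 ≤ m) :
    ∃ r : RatFunc ℂ, Reg ((1 : ℂ) / m) r ∧
      h m = RatFunc.C ((-1) ^ k * c m * (-1 / 16) ^ m) * ss m + r := by
  obtain ⟨X, Y, S, rX, rY, hX0, hY0, hY1, hS0, dX, dY, dS⟩ := exists_XYS
  have hcPS : PowerSeries.mk c = MvPolynomial.aeval ![-X, Y] P := by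
    refine QRep.unique (f := fun τ => MvPolynomial.eval ![xx τ, yy τ] P) ?_ (rX.mvaeval rY P)
    intro τ hτ
    simp only [PowerSeries.coeff_mk]
    exact ⟨hcsum τ hτ, hc τ hτ⟩
  have hXinv : X * X⁻¹ = 1 := PowerSeries.mul_inv_cancel _ (by rw [hX0]; exact one_ne_zero)
  have hXi0 : PowerSeries.constantCoeff X⁻¹ = 1 := by
    have := congrArg PowerSeries.constantCoeff hXinv
    rw [map_mul, hX0, one_mul, map_one] at this
    exact this
  obtain ⟨Y', hY'⟩ := PowerSeries.X_dvd_iff.2 hY0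
  have hY'0 : PowerSeries.constantCoeff Y' = 16 := by
    rw [hY', show (1 : ℕ) = 0 + 1 from rfl, PowerSeries.coeff_succ_X_mul,
      PowerSeries.coeff_zero_eq_constantCoeff_apply] at hY1
    exact hY1
  set U := -(X⁻¹ * Y') with hU
  set u := PowerSeries.X * U with hu
  have hU0 : PowerSeries.constantCoeff U = -16 := by
    rw [hU, map_neg, map_mul, hXi0, hY'0]; norm_num
  have huX : X * u = -Y := by
    rw [hu, hU, hY']
    linear_combination (-PowerSeries.X * Y') * hXinv
  have hex := fun n => phi_exists X Y S u U hX0 hS0 dX dY dS huX hu hU0 n k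
  choose φ G p0 p1 p2 p3 p4 p5 using hex
  have hinit := init_vals k P hP c X Y u U hX0 huX hu hU0 hcPS φ G p4 p5 m
  have hident : ∀ j ≤ m, h j = ∑ n ∈ Finset.range (m + 1),
      RatFunc.C ((-1) ^ k * c n) * Lap n (φ n j) := by
    intro j
    induction j with
    | zero =>
      intro _
      rw [h0, ← hinit 0 (Nat.zero_le _), map_sum]
      refine Finset.sum_congr rfl fun n _ => ?_
      rw [Lap_rec_zero n _ (p0 n), ← map_mul]
    | succ j ih =>
      intro hj
      apply QQ_unique k j (h j)
      rw [hrec j]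
      conv_rhs => rw [ih (by omega), QQ_sum]
      rw [← hinit (j + 1) hj, map_sum, Finset.sum_div]
      refine Finset.sum_congr rfl fun n _ => ?_
      rw [Lap_rec n k j _ _ (p1 n j), map_mul, mul_div_assoc]
  refine ⟨∑ n ∈ Finset.range m, RatFunc.C ((-1) ^ k * c n) * Lap n (φ n m), ?_, ?_⟩
  · refine Reg.sum _ _ fun n hn => (Reg.C _ _).mul (reg_Lap n ?_ _)
    have hm0 : (m : ℂ) ≠ 0 := by exact_mod_cast (by omega : m ≠ 0)
    have hnm : (m : ℂ) ≠ n := by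
      have := Finset.mem_range.1 hn
      exact_mod_cast (by omega : m ≠ n)
    intro h
    apply hnm
    field_simp at h
    linear_combination h
  · rw [hident m le_rfl, Finset.sum_range_succ, p3 m, ← Polynomial.monomial_zero_left, Lap_monomial, bb,
      map_mul _ ((-1) ^ k * c m)]
    simp only [Nat.factorial_zero, Nat.cast_one, pow_zero, one_mul]
    ring


/-- For every `m ≥ 1`, the rational function `h m` has at most a simple pole at `v = 1/m`
and `Res_{v=1/m} h m = (-1)^{m+k+1} c(m)/(m 16^m)`. -/
theorem residue_of_h_general
    (k : ℕ) (hk : 1 ≤ k)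
    (P : MvPolynomial (Fin 2) ℂ) (hP : P.IsHomogeneous k)
    (c : ℕ → ℂ)
    (hcsum : ∀ τ : ℂ, 0 < τ.im →
      Summable (fun n : ℕ => ‖c n * Complex.exp (Real.pi * Complex.I * n * τ)‖))
    (hc : ∀ τ : ℂ, 0 < τ.im →
      MvPolynomial.eval ![xx τ, yy τ] P
        = ∑' n : ℕ, c n * Complex.exp (Real.pi * Complex.I * n * τ))
    (h : ℕ → RatFunc ℂ)
    (hrec : ∀ m : ℕ,
      h m / RatFunc.X - (m : ℂ) • h m
        + ((m : ℂ) - 1 - k) • (if m = 0 then 0 else h (m - 1))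
        - RatFunc.X * ratDeriv (if m = 0 then 0 else h (m - 1))
        + ((2 * (k : ℂ) - 1) / 4) •
            (RatFunc.X * ratDeriv (RatFunc.X * (if m = 0 then 0 else h (m - 1))))
        + (1/4 : ℂ) • (RatFunc.X * ratDeriv (RatFunc.X *
            ratDeriv (RatFunc.X * (if m = 0 then 0 else h (m - 1)))))
      = RatFunc.C ((MvPolynomial.aeval ![1, Polynomial.X] P : Polynomial ℂ).coeff m) /
          RatFunc.X)
    (m : ℕ) (hm : 1 ≤ m) :
    Tendsto (fun v : ℂ => (v - 1 / m) * RatFunc.eval (RingHom.id ℂ) v (h m))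
      (𝓝[≠] ((1 : ℂ) / m))
      (𝓝 ((-1 : ℂ) ^ (m + k + 1) * c m / (m * 16 ^ m))) := by
  have hX : (RatFunc.X : RatFunc ℂ) ≠ 0 := RatFunc.X_ne_zero
  have h0 : h 0 = RatFunc.C ((MvPolynomial.aeval ![1, Polynomial.X] P : Polynomial ℂ).coeff 0) := by
    have := hrec 0
    simp only [if_true, Nat.cast_zero, zero_smul, smul_zero, mul_zero, rd_zero, sub_zero,
      add_zero] at this
    exact (div_left_inj' hX).1 this
  have hrec' : ∀ m : ℕ, QQ k m (h m) (h (m + 1)) =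
      RatFunc.C ((MvPolynomial.aeval ![1, Polynomial.X] P : Polynomial ℂ).coeff (m + 1)) /
        RatFunc.X := by
    intro m
    rw [← hrec (m + 1), QQ]
    simp only [Nat.succ_ne_zero, if_false, Nat.add_sub_cancel, RatFunc.smul_eq_C_mul]
    push_cast
    rw [show (m : ℂ) + 1 - 1 - k = m - k by ring]
  obtain ⟨r, hr, hhm⟩ := residue_core k P hP c hcsum hc h h0 hrec' m hm
  rw [hhm]
  have hlim := residue_limit m hm ((-1) ^ k * c m * (-1 / 16) ^ m) r hr
  convert hlim using 2
  rw [div_pow, pow_succ, pow_add]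
  have hm0 : (m : ℂ) ≠ 0 := by exact_mod_cast (by omega : m ≠ 0)
  field_simp
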